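/- arXiv:1608.05157 — 7 statements merged into one kernel-verified Lean document; each statement's English description precedes it below -/
import Mathlib

section
/- Let p be a prime and let G be a finite abelian p-group with Davenport constant D(G) ≤ 2·exp(G) − 1. Then 2·D(G) − 1 = η(G) + exp(G) − 1; equivalently, η(G) = 2·D(G) − exp(G). -/
/-- The zero-sum invariant `s_L(G)`: the smallest positive integer `ℓ` such that every
sequence (multiset) over `G` of length at least `ℓ` contains a nonempty zero-sum
subsequence whose length lies in `L`. -/
noncomputable def zsInv (G : Type*) [AddCommGroup G] (L : Set ℕ) : ℕ :=
  sInf {ℓ : ℕ | 0 < ℓ ∧ ∀ S : Multiset G, ℓ ≤ Multiset.card S →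
    ∃ T : Multiset G, T ≤ S ∧ T ≠ 0 ∧ T.sum = 0 ∧ Multiset.card T ∈ L}

/-- The Davenport constant `D(G)`. -/
noncomputable def davenport (G : Type*) [AddCommGroup G] : ℕ := zsInv G {t | 0 < t}

/-- The η-invariant `η(G) = s_{[1, exp(G)]}(G)`. -/
noncomputable def etaInv (G : Type*) [AddCommGroup G] : ℕ :=
  zsInv G {t | 0 < t ∧ t ≤ AddMonoid.exponent G}

/-- The Erdős–Ginzburg–Ziv constant `s(G) = s_{{exp(G)}}(G)`. -/
noncomputable def egzConst (G : Type*) [AddCommGroup G] : ℕ :=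
  zsInv G {AddMonoid.exponent G}

/-- `η_i(G) = s_{[i, exp(G)]}(G)`. -/
noncomputable def etaI (G : Type*) [AddCommGroup G] (i : ℕ) : ℕ :=
  zsInv G {t | i ≤ t ∧ t ≤ AddMonoid.exponent G}

/-- `ζ_i(G) = s_{[i-n,0] + nℕ⁺}(G)` where `n = exp(G)`: the invariant for zero-sum
subsequences whose length is congruent mod `n` to some residue `r` with `i ≤ r ≤ n`. -/
noncomputable def zetaI (G : Type*) [AddCommGroup G] (i : ℕ) : ℕ :=
  zsInv G {t | 0 < t ∧ ∃ r : ℕ, i ≤ r ∧ r ≤ AddMonoid.exponent G ∧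
    t % AddMonoid.exponent G = r % AddMonoid.exponent G}

lemma zsInv_eq_card_add_one {G : Type*} [AddCommGroup G] {L : Set ℕ} {m : ℕ}
    (hup : ∀ S : Multiset G, m ≤ S.card → ∃ T ≤ S, T ≠ 0 ∧ T.sum = 0 ∧ T.card ∈ L)
    (S : Multiset G) (hcard : S.card + 1 = m)
    (hS : ∀ T ≤ S, T ≠ 0 → T.sum = 0 → T.card ∉ L) : zsInv G L = m := by
  apply le_antisymm
  · exact Nat.sInf_le ⟨by omega, hup⟩
  · refine le_csInf ⟨m, by omega, hup⟩ fun ℓ hℓ => ?_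
    by_contra! h
    obtain ⟨T, hT, h0, hsum, hL⟩ := hℓ.2 S (by omega)
    exact hS T hT h0 hsum hL

lemma Multiset.exists_eq_add_of_le_add {α : Type*} {s t u : Multiset α} (h : s ≤ t + u) :
    ∃ a ≤ t, ∃ b ≤ u, s = a + b := by
  classical
  refine ⟨s ∩ t, Multiset.inter_le_right, s - t, Multiset.sub_le_iff_le_add'.2 h, ?_⟩
  rw [add_comm, Multiset.sub_add_inter]

lemma Multiset.exists_le_card_eq_of_le_card {α : Type*} {s : Multiset α} {n : ℕ}
    (h : n ≤ s.card) : ∃ t ≤ s, t.card = n := by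
  induction s using Quotient.inductionOn with
  | h l => exact ⟨(l.take n : List α), (l.take_sublist n).subperm, by simpa using h⟩

lemma Multiset.exists_eq_map_of_le_map {α β : Type*} {f : α → β} {s : Multiset β}
    {t : Multiset α} (h : s ≤ t.map f) : ∃ a ≤ t, s = a.map f := by
  induction t using Multiset.induction_on generalizing s with
  | empty => exact ⟨0, le_rfl, by simpa using h⟩
  | cons x t ih =>
    rw [← Multiset.singleton_add, Multiset.map_add, Multiset.map_singleton] at h
    obtain ⟨a, ha, b, hb, rfl⟩ := Multiset.exists_eq_add_of_le_add h
    obtain ⟨c, hc, rfl⟩ := ih hb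
    rcases Multiset.le_singleton.1 ha with rfl | rfl
    · exact ⟨c, hc.trans (Multiset.le_cons_self t x), by simp⟩
    · exact ⟨x ::ₘ c, Multiset.cons_le_cons x hc, by simp⟩

lemma Multiset.exists_eq_sum_replicate_of_le {α ι : Type*} {b : ι → α} {m : ι → ℕ}
    {s : Finset ι} {A : Multiset α} (h : A ≤ ∑ i ∈ s, Multiset.replicate (m i) (b i)) :
    ∃ c : ι → ℕ, (∀ i ∈ s, c i ≤ m i) ∧ A = ∑ i ∈ s, Multiset.replicate (c i) (b i) := by
  classical
  induction s using Finset.induction_on generalizing A with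
  | empty => exact ⟨0, by simp, by simpa using h⟩
  | insert i s hi ih =>
    rw [Finset.sum_insert hi] at h
    obtain ⟨X, hX, Y, hY, rfl⟩ := Multiset.exists_eq_add_of_le_add h
    obtain ⟨c, hc, rfl⟩ := ih hY
    obtain ⟨k, hk, rfl⟩ := Multiset.le_replicate_iff.1 hX
    refine ⟨Function.update c i k, fun j hj => ?_, ?_⟩
    · rcases eq_or_ne j i with rfl | hji
      · simpa using hk
      · simpa [hji] using hc j (Finset.mem_of_mem_insert_of_ne hj hji)
    · rw [Finset.sum_insert hi, Function.update_self]
      congr 1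
      exact Finset.sum_congr rfl fun j hj => by
        rw [Function.update_of_ne (ne_of_mem_of_not_mem hj hi)]

section GroupRing

open AddMonoidAlgebra

variable {R G : Type*} [CommRing R] [AddCommGroup G]

lemma exists_subsequence_of_coeff_prod_ne (S : Multiset G) (h : G)
    (hne : (S.map fun g => (1 - single g 1 : R[G])).prod.coeff h ≠ (1 : R[G]).coeff h) :
    ∃ T ≤ S, T ≠ 0 ∧ T.sum = h := by
  classical
  induction S using Multiset.induction_on generalizing h with
  | empty => simp at hne
  | cons g S ih =>
    rw [Multiset.map_cons, Multiset.prod_cons, sub_mul, one_mul] at hne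
    by_cases h₁ : (S.map fun g => (1 - single g 1 : R[G])).prod.coeff h = (1 : R[G]).coeff h
    · have h₂ : (S.map fun g => (1 - single g 1 : R[G])).prod.coeff (-g + h) ≠ 0 := by
        intro h₂
        apply hne
        simp [h₁, h₂, coeff_single_mul_apply]
      by_cases h₃ : h = g
      · exact ⟨{g}, by simp, by simp, by simp [h₃]⟩
      · obtain ⟨T, hT, -, hsum⟩ := ih (-g + h) (by
          rwa [one_def, coeff_single, Finsupp.single_apply, if_neg]
          intro h₄
          apply h₃
          rw [eq_neg_add_iff_add_eq, add_zero] at h₄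
          exact h₄.symm)
        exact ⟨g ::ₘ T, Multiset.cons_le_cons g hT, by simp, by simp [hsum]⟩
    · obtain ⟨T, hT, h0, hsum⟩ := ih h h₁
      exact ⟨T, hT.trans (Multiset.le_cons_self S g), h0, hsum⟩

end GroupRing

lemma Ideal.span_range_pow_eq_bot {R ι : Type*} [CommRing R] [Fintype ι] {a : ι → R}
    {q : ι → ℕ} (ha : ∀ i, a i ^ q i = 0) {N : ℕ} (hN : ∑ i, (q i - 1) < N) :
    Ideal.span (Set.range a) ^ N = ⊥ := by
  classical
  rw [Ideal.span, Submodule.span_pow, Submodule.span_eq_bot]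
  intro x hx
  obtain ⟨f, rfl⟩ := Set.mem_pow.1 hx
  choose g hg using fun j => (f j).2
  have hcard : N = ∑ i, (Finset.univ.filter fun j => g j = i).card := by
    simpa using Finset.card_eq_sum_card_fiberwise (s := Finset.univ) (t := Finset.univ) (f := g)
      (fun _ _ => by simp)
  obtain ⟨i, -, hi⟩ := Finset.exists_lt_of_sum_lt (hcard ▸ hN)
  rw [List.prod_ofFn, ← Finset.prod_filter_mul_prod_filter_not _ (fun j => g j = i)]
  have : ∏ j with g j = i, (f j : R) = 0 := by
    rw [Finset.prod_congr rfl (g := fun _ => a i) (fun j hj => by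
      rw [← hg, (Finset.mem_filter.1 hj).2]), Finset.prod_const]
    exact pow_eq_zero_of_le (by omega) (ha i)
  rw [this, zero_mul]

lemma exists_zero_sum_of_sum_lt_card {p : ℕ} (hp : p.Prime) {K ι : Type*} [AddCommGroup K]
    [Fintype ι] {b : ι → K} {e : ι → ℕ} (hb : ∀ i, p ^ e i • b i = 0)
    (hgen : AddSubgroup.closure (Set.range b) = ⊤) {S : Multiset K}
    (hS : ∑ i, (p ^ e i - 1) < S.card) : ∃ T ≤ S, T ≠ 0 ∧ T.sum = 0 := by
  open AddMonoidAlgebra in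
  have : Fact p.Prime := ⟨hp⟩
  set a : ι → (ZMod p)[K] := fun i => 1 - single (b i) 1 with ha
  have hpow : ∀ i, a i ^ p ^ e i = 0 := by
    intro i
    have : CharP (ZMod p)[K] p := charP_of_injective_algebraMap
      (algebraMap (ZMod p) (ZMod p)[K]).injective p
    rw [ha, sub_pow_char_pow, single_pow, hb]
    simp [one_def]
  have hmem : ∀ g : K, (1 - single g 1 : (ZMod p)[K]) ∈ Ideal.span (Set.range a) := by
    intro g
    have hg : g ∈ AddSubgroup.closure (Set.range b) := hgen ▸ AddSubgroup.mem_top g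
    induction hg using AddSubgroup.closure_induction with
    | mem x hx =>
      obtain ⟨i, rfl⟩ := hx
      exact Ideal.subset_span ⟨i, rfl⟩
    | zero => simp [one_def]
    | add x y _ _ hx hy =>
      have : (1 - single (x + y) 1 : (ZMod p)[K])
          = (1 - single x 1) + single x 1 * (1 - single y 1) := by
        rw [mul_sub, single_mul_single]; simp
      rw [this]
      exact add_mem hx (Ideal.mul_mem_left _ _ hy)
    | neg x _ hx =>
      have : (1 - single (-x) 1 : (ZMod p)[K]) = -single (-x) 1 * (1 - single x 1) := by
        rw [neg_mul, mul_sub, single_mul_single]; simp [one_def]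
      rw [this]
      exact Ideal.mul_mem_left _ _ hx
  have hprod : ∀ S : Multiset K, (S.map fun g => (1 - single g 1 : (ZMod p)[K])).prod ∈
      Ideal.span (Set.range a) ^ S.card := by
    intro S
    induction S using Multiset.induction_on with
    | empty => simp
    | cons g S ih =>
      rw [Multiset.map_cons, Multiset.prod_cons, Multiset.card_cons, pow_succ']
      exact Ideal.mul_mem_mul (hmem g) ih
  have hzero := hprod S
  rw [Ideal.span_range_pow_eq_bot hpow hS, Ideal.mem_bot] at hzero
  exact exists_subsequence_of_coeff_prod_ne (R := ZMod p) S 0 (by rw [hzero]; simp [one_def])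

lemma exists_primePow_basis {p : ℕ} (hp : p.Prime) (G : Type*) [AddCommGroup G] [Finite G]
    (hpG : ∀ g : G, ∃ k : ℕ, p ^ k • g = 0) :
    ∃ (ι : Type) (_ : Fintype ι) (_ : Nonempty ι) (b : ι → G) (e : ι → ℕ),
      AddSubgroup.closure (Set.range b) = ⊤ ∧ (∀ i, p ^ e i • b i = 0) ∧
      ∀ c : ι → ℕ, ∑ i, c i • b i = 0 → ∀ i, p ^ e i ∣ c i := by
  classical
  obtain ⟨ι, _, n, hn, ⟨φ₀⟩⟩ := AddCommGroup.equiv_directSum_zmod_of_finite' G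
  let φ : G ≃+ (∀ i, ZMod (n i)) := φ₀.trans (DirectSum.addEquivProd _)
  let b : ι → G := fun i => φ.symm (Pi.single i 1)
  have hφb : ∀ i, φ (b i) = Pi.single i 1 := fun i => φ.apply_symm_apply _
  have hindep : ∀ c : ι → ℕ, ∑ i, c i • b i = 0 → ∀ i, n i ∣ c i := by
    intro c hc i
    have h := congrFun (congrArg φ hc) i
    simp only [map_sum, map_nsmul, hφb, map_zero, Finset.sum_apply, Pi.smul_apply,
      Pi.zero_apply] at h
    rw [Finset.sum_eq_single i (fun j _ hj => by simp [Pi.single_eq_of_ne hj.symm]) (by simp)] at h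
    simpa [ZMod.natCast_eq_zero_iff] using h
  have hpow : ∀ i, ∃ m, n i = p ^ m := by
    intro i
    obtain ⟨k, hk⟩ := hpG (b i)
    have := hindep (Pi.single i (p ^ k)) (by
      rw [Finset.sum_eq_single i (fun j _ hj => by simp [Pi.single_eq_of_ne hj]) (by simp)]
      simpa using hk) i
    rw [Pi.single_eq_same, Nat.dvd_prime_pow hp] at this
    exact ⟨_, this.choose_spec.2⟩
  choose m hm using hpow
  have hgen : ∀ g, g ∈ AddSubgroup.closure (Set.range b) := by
    intro g
    have : g = ∑ i, ((φ g i).cast : ℤ) • b i := by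
      apply φ.injective
      ext i
      simp only [map_sum, map_zsmul, hφb, Finset.sum_apply, Pi.smul_apply]
      rw [Finset.sum_eq_single i (fun j _ hj => by simp [Pi.single_eq_of_ne hj.symm]) (by simp)]
      simp
    rw [this]
    exact sum_mem fun i _ => zsmul_mem (AddSubgroup.subset_closure (Set.mem_range_self i)) _
  refine ⟨Option ι, inferInstance, ⟨none⟩, fun i => i.elim 0 b, fun i => i.elim 0 m, ?_, ?_, ?_⟩
  · refine (AddSubgroup.eq_top_iff' _).2 fun g => AddSubgroup.closure_mono ?_ (hgen g)
    rintro _ ⟨i, rfl⟩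
    exact ⟨some i, rfl⟩
  · rintro (_ | i)
    · simp
    · apply φ.injective
      simp only [Option.elim_some, map_nsmul, hφb, map_zero, ← hm]
      rw [← Pi.single_smul]
      simp
  · intro c hc
    rw [Fintype.sum_option] at hc
    rintro (_ | i)
    · simp
    · change p ^ m i ∣ _
      rw [← hm]
      exact hindep (fun i => c (some i)) (by simpa using hc) i

lemma Multiset.sum_sum_replicate {ι M : Type*} [AddCommMonoid M] (s : Finset ι) (c : ι → ℕ)
    (b : ι → M) : (∑ i ∈ s, Multiset.replicate (c i) (b i)).sum = ∑ i ∈ s, c i • b i := by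
  rw [← Multiset.coe_sumAddMonoidHom, map_sum]
  simp

lemma Multiset.sum_map_prodMk_one {G R : Type*} [AddCommMonoid G] [AddCommMonoidWithOne R]
    (T : Multiset G) : (T.map fun g => (g, (1 : R))).sum = (T.sum, (T.card : R)) := by
  induction T using Multiset.induction_on with
  | empty => simp [Prod.zero_eq_mk]
  | cons x T ih => simp [ih, add_comm]

/-- A finite abelian `p`-group of exponent `n` has an element `f` of order `n` and a zero-sum free
sequence `T₀` over a complement of `⟨f⟩` such that `D(G) ≤ n + |T₀|` and
`D(G ⊕ C_n) ≤ 2 * n - 1 + |T₀|`. -/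
lemma exists_extremal_data {p : ℕ} (hp : p.Prime) (G : Type*) [AddCommGroup G] [Finite G]
    (hpG : ∀ g : G, ∃ k : ℕ, p ^ k • g = 0) :
    ∃ (f : G) (T₀ : Multiset G),
      (∀ A ≤ T₀, A.sum = 0 → A = 0) ∧
      (∀ A ≤ T₀, ∀ B ≤ T₀, ∀ k : ℕ, A.sum + B.sum + k • f = 0 → AddMonoid.exponent G ∣ k) ∧
      (∀ S : Multiset G, AddMonoid.exponent G + T₀.card ≤ S.card →
        ∃ T ≤ S, T ≠ 0 ∧ T.sum = 0) ∧
      (∀ S : Multiset (G × ZMod (AddMonoid.exponent G)),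
        2 * AddMonoid.exponent G + T₀.card ≤ S.card + 1 → ∃ T ≤ S, T ≠ 0 ∧ T.sum = 0) := by
  classical
  obtain ⟨ι, _, _, b, e, hgen, hb, hindep⟩ := exists_primePow_basis hp G hpG
  obtain ⟨i₀, hi₀⟩ := Finite.exists_max e
  have hexp : AddMonoid.exponent G = p ^ e i₀ := by
    apply Nat.dvd_antisymm
    · refine AddMonoid.exponent_dvd_of_forall_nsmul_eq_zero fun g => ?_
      have hg : g ∈ AddSubgroup.closure (Set.range b) := hgen ▸ AddSubgroup.mem_top g
      induction hg using AddSubgroup.closure_induction with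
      | mem x hx =>
        obtain ⟨i, rfl⟩ := hx
        obtain ⟨k, hk⟩ := pow_dvd_pow p (hi₀ i)
        rw [hk, mul_comm, mul_nsmul', hb, nsmul_zero]
      | zero => simp
      | add x y _ _ hx hy => rw [nsmul_add, hx, hy, add_zero]
      | neg x _ hx => rw [smul_neg, hx, neg_zero]
    · have := hindep (Pi.single i₀ (AddMonoid.exponent G)) (by
        rw [Finset.sum_eq_single i₀ (fun j _ hj => by simp [Pi.single_eq_of_ne hj]) (by simp)]
        simpa using AddMonoid.exponent_nsmul_eq_zero (b i₀)) i₀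
      simpa using this
  have hpos : ∀ i, 0 < p ^ e i := fun i => pow_pos hp.pos _
  set s : Finset ι := Finset.univ.erase i₀
  have hcard : (∑ i ∈ s, Multiset.replicate (p ^ e i - 1) (b i)).card = ∑ i ∈ s, (p ^ e i - 1) := by
    simp
  have hsplit : ∑ i, (p ^ e i - 1) = p ^ e i₀ - 1 + ∑ i ∈ s, (p ^ e i - 1) :=
    (Finset.add_sum_erase _ _ (Finset.mem_univ i₀)).symm
  have hcoeff : ∀ (c : ι → ℕ) (k : ℕ), ∑ i ∈ s, c i • b i + k • b i₀ = 0 →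
      p ^ e i₀ ∣ k ∧ ∀ i ∈ s, p ^ e i ∣ c i := by
    intro c k h
    have h' := hindep (Function.update c i₀ k) (by
      rw [← Finset.add_sum_erase _ _ (Finset.mem_univ i₀), Function.update_self, add_comm, ← h]
      congr 1
      exact Finset.sum_congr rfl fun j hj => by
        rw [Function.update_of_ne (Finset.ne_of_mem_erase hj)])
    refine ⟨by simpa using h' i₀, fun i hi => ?_⟩
    simpa [Function.update_of_ne (Finset.ne_of_mem_erase hi)] using h' i
  refine ⟨b i₀, ∑ i ∈ s, Multiset.replicate (p ^ e i - 1) (b i), ?_, ?_, ?_, ?_⟩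
  · intro A hA hsum
    obtain ⟨c, hc, rfl⟩ := Multiset.exists_eq_sum_replicate_of_le hA
    rw [Multiset.sum_sum_replicate] at hsum
    have hdvd := (hcoeff c 0 (by simpa using hsum)).2
    refine Finset.sum_eq_zero fun i hi => ?_
    have := hc i hi
    have := hpos i
    rw [Nat.eq_zero_of_dvd_of_lt (hdvd i hi) (by omega), Multiset.replicate_zero]
  · intro A hA B hB k hsum
    obtain ⟨c, -, rfl⟩ := Multiset.exists_eq_sum_replicate_of_le hA
    obtain ⟨c', -, rfl⟩ := Multiset.exists_eq_sum_replicate_of_le hB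
    rw [Multiset.sum_sum_replicate, Multiset.sum_sum_replicate, ← Finset.sum_add_distrib] at hsum
    rw [hexp]
    exact (hcoeff (c + c') k (by simpa [add_nsmul] using hsum)).1
  · intro S hS
    rw [hcard, hexp] at hS
    have := hpos i₀
    exact exists_zero_sum_of_sum_lt_card hp hb hgen (by omega)
  · rw [hcard, hexp]
    intro S hS
    have := hpos i₀
    refine exists_zero_sum_of_sum_lt_card hp (ι := Option ι)
      (b := fun i => i.elim (0, 1) fun i => (b i, 0)) (e := fun i => i.elim (e i₀) e) ?_ ?_ ?_
    · rintro (_ | i)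
      · simp
      · simp [hb]
    · refine (AddSubgroup.eq_top_iff' _).2 fun ⟨g, z⟩ => ?_
      set H := AddSubgroup.closure (Set.range fun i : Option ι =>
        (i.elim (0, 1) fun i => (b i, 0) : G × ZMod (p ^ e i₀))) with hH
      have h₁ : ((g, 0) : G × ZMod (p ^ e i₀)) ∈ H := by
        have hle : AddSubgroup.closure (Set.range b) ≤
            H.comap (AddMonoidHom.inl G (ZMod (p ^ e i₀))) := by
          rw [AddSubgroup.closure_le]
          rintro _ ⟨i, rfl⟩
          exact AddSubgroup.subset_closure ⟨some i, rfl⟩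
        exact hle (hgen ▸ AddSubgroup.mem_top g)
      have h₂ : ((0, z) : G × ZMod (p ^ e i₀)) ∈ H := by
        have : ((0, z) : G × ZMod (p ^ e i₀)) = (z.cast : ℤ) • (0, 1) := by simp
        rw [this]
        exact zsmul_mem (AddSubgroup.subset_closure (Set.mem_range_self none)) _
      simpa using add_mem h₁ h₂
    · rw [Fintype.sum_option]
      simp only [Option.elim_none, Option.elim_some]
      omega

/-- For a finite abelian `p`-group `G` with `D(G) ≤ 2·exp(G) − 1`,
we have `2·D(G) − 1 = η(G) + exp(G) − 1`; equivalently, `η(G) = 2·D(G) − exp(G)`. -/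
theorem stmt0 (p : ℕ) (hp : p.Prime) (G : Type*) [AddCommGroup G] [Finite G]
    (hpG : ∀ g : G, ∃ k : ℕ, p ^ k • g = 0)
    (hD : davenport G ≤ 2 * AddMonoid.exponent G - 1) :
    2 * davenport G - 1 = etaInv G + AddMonoid.exponent G - 1 ∧
      etaInv G = 2 * davenport G - AddMonoid.exponent G := by
  obtain ⟨f, T₀, hfree, hdvd, hOlson, hOlson'⟩ := exists_extremal_data hp G hpG
  have hnf : ∀ g : G, AddMonoid.exponent G • g = 0 := AddMonoid.exponent_nsmul_eq_zero
  have hn : 0 < AddMonoid.exponent G := AddMonoid.exponent_pos.2 AddMonoid.ExponentExists.of_finite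
  set n := AddMonoid.exponent G with hn_def
  have hdav : davenport G = n + T₀.card := by
    refine zsInv_eq_card_add_one (fun S hS => ?_) (T₀ + Multiset.replicate (n - 1) f)
      (by simp; omega) fun T hT h0 hsum _ => ?_
    · obtain ⟨T, hT, h0, hsum⟩ := hOlson S hS
      exact ⟨T, hT, h0, hsum, Multiset.card_pos.2 h0⟩
    · obtain ⟨A, hA, B, hB, rfl⟩ := Multiset.exists_eq_add_of_le_add hT
      obtain ⟨k, hk, rfl⟩ := Multiset.le_replicate_iff.1 hB
      rw [Multiset.sum_add, Multiset.sum_replicate] at hsum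
      have hk0 : k = 0 := Nat.eq_zero_of_dvd_of_lt
        (hdvd A hA 0 (Multiset.zero_le _) k (by simpa using hsum)) (by omega)
      subst hk0
      apply h0
      simpa using hfree A hA (by simpa using hsum)
  have heta : etaInv G = n + 2 * T₀.card := by
    refine zsInv_eq_card_add_one (fun S hS => ?_)
      (T₀ + (T₀.map (· + f) + Multiset.replicate (n - 1) f)) (by simp; omega)
      (fun T hT h0 hsum hlen => ?_)
    · obtain ⟨S', hS', hcard⟩ := Multiset.exists_le_card_eq_of_le_card hS
      obtain ⟨U, hU, hU0, hUsum⟩ := hOlson' (S'.map (fun g => (g, 1)) +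
        Multiset.replicate (n - 1 - T₀.card) (0, 1)) (by simp; omega)
      obtain ⟨A, hA, B, hB, rfl⟩ := Multiset.exists_eq_add_of_le_add hU
      obtain ⟨T, hT, rfl⟩ := Multiset.exists_eq_map_of_le_map hA
      obtain ⟨k, hk, rfl⟩ := Multiset.le_replicate_iff.1 hB
      rw [Multiset.sum_add, Multiset.sum_map_prodMk_one, Multiset.sum_replicate] at hUsum
      have hTsum : T.sum = 0 := by simpa using congrArg Prod.fst hUsum
      have hTcard : n ∣ T.card + k := by
        rw [← ZMod.natCast_eq_zero_iff]
        simpa using congrArg Prod.snd hUsum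
      have hTle := Multiset.card_le_card hT
      have hT0 : T ≠ 0 := by
        rintro rfl
        have := Nat.eq_zero_of_dvd_of_lt hTcard (by simp; omega)
        apply hU0
        simp_all
      have hTpos := Multiset.card_pos.2 hT0
      by_cases hTn : T.card ≤ n
      · exact ⟨T, hT.trans hS', hT0, hTsum, hTpos, hTn⟩
      have h2n : T.card + k = 2 * n := by
        obtain ⟨c, hc⟩ := hTcard
        have : 1 < c := by
          by_contra! h
          have := Nat.mul_le_mul_left n h
          omega
        have : c < 3 := by
          by_contra! h
          have := Nat.mul_le_mul_left n h
          omega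
        obtain rfl : c = 2 := by omega
        omega
      obtain ⟨x, hx⟩ := Multiset.exists_mem_of_ne_zero hT0
      obtain ⟨R, rfl⟩ := Multiset.exists_cons_of_mem hx
      obtain ⟨V, hV, hV0, hVsum⟩ := hOlson R (by simp at h2n; omega)
      obtain ⟨W, rfl⟩ := Multiset.le_iff_exists_add.1 hV
      have hWsum : (x ::ₘ W).sum = 0 := by
        rw [← Multiset.add_cons, Multiset.sum_add, hVsum, zero_add] at hTsum
        exact hTsum
      have hVpos := Multiset.card_pos.2 hV0
      rw [← Multiset.add_cons] at hT h2n
      rw [Multiset.card_add] at h2n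
      by_cases hVn : V.card ≤ n
      · exact ⟨V, (Multiset.le_add_right _ _).trans (hT.trans hS'), hV0, hVsum, hVpos, hVn⟩
      · exact ⟨x ::ₘ W, (Multiset.le_add_left _ _).trans (hT.trans hS'), by simp, hWsum,
          by simp, by omega⟩
    · obtain ⟨A, hA, C, hC, rfl⟩ := Multiset.exists_eq_add_of_le_add hT
      obtain ⟨B', hB', K, hK, rfl⟩ := Multiset.exists_eq_add_of_le_add hC
      obtain ⟨B, hB, rfl⟩ := Multiset.exists_eq_map_of_le_map hB'
      obtain ⟨k, hk, rfl⟩ := Multiset.le_replicate_iff.1 hK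
      have hsum' : A.sum + B.sum + (B.card + k) • f = 0 := by
        rw [← hsum]
        simp [Multiset.sum_map_add, add_nsmul, add_assoc]
      have hdvd' := hdvd A hA B hB _ hsum'
      have hAB : A.sum + B.sum = 0 := by
        obtain ⟨c, hc⟩ := hdvd'
        rwa [hc, mul_nsmul', nsmul_left_comm, hnf, nsmul_zero, add_zero] at hsum'
      have hlen' : A.card + (B.card + k) ≤ n := by simpa using hlen.2
      have hB0 : B = 0 := by
        by_contra hB0
        have hpos := Multiset.card_pos.2 hB0
        have := Nat.le_of_dvd (by omega) hdvd'
        have hA0 : A = 0 := Multiset.card_eq_zero.1 (by omega)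
        exact hB0 (hfree B hB (by simpa [hA0] using hAB))
      subst hB0
      have hA0 := hfree A hA (by simpa using hAB)
      have hk0 := Nat.eq_zero_of_dvd_of_lt hdvd' (by simp; omega)
      apply h0
      simp_all
  omega
end

section
/- Let p be a prime, let G be a finite abelian p-group with Davenport constant D(G) ≤ 2·exp(G) − 1, and let a be a positive integer not divisible by p. Then the group G' = C_a ⊕ G satisfies 2·D(G') − 1 = η(G') + exp(G') − 1; equivalently, η(G') = 2·D(G') − exp(G'). -/
namespace Multiset

variable {α β : Type*}

theorem exists_le_map_eq_of_le_map (f : α → β) {S : Multiset α} {T : Multiset β}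
    (h : T ≤ S.map f) : ∃ U ≤ S, U.map f = T := by
  classical
  induction S using Multiset.induction_on generalizing T with
  | empty => exact ⟨0, le_rfl, by simpa [eq_comm] using h⟩
  | cons a S ih =>
    rw [map_cons] at h
    by_cases ha : f a ∈ T
    · obtain ⟨T, rfl⟩ := exists_cons_of_mem ha
      obtain ⟨U, hU, rfl⟩ := ih ((cons_le_cons_iff _).1 h)
      exact ⟨a ::ₘ U, (cons_le_cons_iff _).2 hU, map_cons ..⟩
    · obtain ⟨U, hU, rfl⟩ := ih ((le_cons_of_notMem ha).1 h)
      exact ⟨U, hU.trans (le_cons_self _ _), rfl⟩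

theorem exists_le_card_eq_of_le_card_s1 {S : Multiset α} {n : ℕ} (h : n ≤ card S) :
    ∃ T ≤ S, card T = n := by
  have hpos : 0 < card (powersetCard n S) := by
    rw [card_powersetCard]
    exact Nat.choose_pos h
  obtain ⟨T, hT⟩ := card_pos_iff_exists_mem.1 hpos
  exact ⟨T, mem_powersetCard.1 hT⟩

theorem exists_eq_add_of_le_add_s1 {S A B : Multiset α} (h : S ≤ A + B) :
    ∃ A' ≤ A, ∃ B' ≤ B, S = A' + B' := by
  classical
  refine ⟨S ∩ A, inter_le_right, S - A, tsub_le_iff_left.2 h, ?_⟩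
  rw [add_comm, sub_add_inter]

theorem pow_card_dvd_prod_map {R : Type*} [CommMonoid R] {r : R} {f : α → R} (h : ∀ x, r ∣ f x)
    (S : Multiset α) : r ^ card S ∣ (S.map f).prod := by
  induction S using Multiset.induction_on with
  | empty => simp
  | cons a S ih =>
    rw [card_cons, map_cons, prod_cons, pow_succ']
    exact mul_dvd_mul (h a) ih

theorem multiset_sum_mono {B C : Multiset (Multiset α)} (h : C ≤ B) :
    C.sum ≤ B.sum := by
  obtain ⟨D, rfl⟩ := Multiset.le_iff_exists_add.1 h
  rw [sum_add]
  exact le_add_right _ _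

theorem card_sum_le {n : ℕ} {B : Multiset (Multiset α)} (h : ∀ b ∈ B, card b ≤ n) :
    card B.sum ≤ card B * n := by
  have hcs : card B.sum = (B.map card).sum := card_join B
  rw [hcs, ← smul_eq_mul, ← card_map card B]
  refine sum_le_card_nsmul _ _ fun x hx ↦ ?_
  obtain ⟨b, hb, rfl⟩ := Multiset.mem_map.1 hx
  exact h b hb

end Multiset

open Multiset

/-- A sequence is zero-sum free if its only zero-sum subsequence is the empty one. -/
def ZeroSumFree {G : Type*} [AddCommGroup G] (S : Multiset G) : Prop :=
  ∀ T ≤ S, T.sum = 0 → T = 0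

/-- Every sequence of length at least `ℓ` has a nonempty zero-sum subsequence with length
in `L`. -/
def HasZeroSums (G : Type*) [AddCommGroup G] (L : Set ℕ) (ℓ : ℕ) : Prop :=
  ∀ S : Multiset G, ℓ ≤ card S → ∃ T ≤ S, T ≠ 0 ∧ T.sum = 0 ∧ card T ∈ L

/-- The product `∏ (1 - X ^ g)` over a sequence in the group algebra `𝔽_p[G]`. -/
noncomputable def augProd (p : ℕ) {G : Type*} [AddCommGroup G] (S : Multiset G) :
    AddMonoidAlgebra (ZMod p) G :=
  (S.map fun g ↦ 1 - AddMonoidAlgebra.single g 1).prod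

/-- All products of `d` elements `1 - X ^ g` of the group algebra `𝔽_p[G]` vanish. -/
def AugNilpotent (p : ℕ) (G : Type*) [AddCommGroup G] (d : ℕ) : Prop :=
  ∀ S : Multiset G, d ≤ card S → augProd p S = 0

section GroupAlgebra

variable {p : ℕ} {G H : Type*} [AddCommGroup G] [AddCommGroup H]

theorem augProd_cons (g : G) (S : Multiset G) :
    augProd p (g ::ₘ S) = (1 - AddMonoidAlgebra.single g 1) * augProd p S := by
  simp [augProd]

theorem map_augProd (f : G →+ H) (S : Multiset G) :
    AddMonoidAlgebra.mapDomainRingHom (ZMod p) f (augProd p S) = augProd p (S.map f) := by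
  simp only [augProd, map_multiset_prod, Multiset.map_map]
  congr 1
  refine Multiset.map_congr rfl fun g _ ↦ ?_
  rw [Function.comp_apply, map_sub, map_one]
  simp

theorem coeff_augProd_cons (g : G) (S : Multiset G) (x : G) :
    (augProd p (g ::ₘ S)).coeff x = (augProd p S).coeff x - (augProd p S).coeff (x - g) := by
  rw [augProd_cons, sub_mul, one_mul]
  have := AddMonoidAlgebra.coeff_single_mul_apply (augProd p S) 1 g x
  simp [this, sub_eq_neg_add]

theorem exists_sum_eq_of_coeff_augProd_ne_zero {S : Multiset G} {x : G}
    (h : (augProd p S).coeff x ≠ 0) : ∃ T ≤ S, T.sum = x := by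
  induction S using Multiset.induction_on generalizing x with
  | empty =>
    refine ⟨0, le_rfl, ?_⟩
    by_contra hx
    rw [sum_zero] at hx
    exact h (by simp [augProd, AddMonoidAlgebra.one_def, Finsupp.single_eq_of_ne' hx])
  | cons g S ih =>
    rw [coeff_augProd_cons] at h
    by_cases h0 : (augProd p S).coeff x = 0
    · obtain ⟨T, hT, hs⟩ := ih (x := x - g) (fun h1 ↦ h (by rw [h0, h1, sub_zero]))
      exact ⟨g ::ₘ T, (cons_le_cons_iff _).2 hT, by rw [sum_cons, hs]; abel⟩
    · obtain ⟨T, hT, hs⟩ := ih h0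
      exact ⟨T, hT.trans (le_cons_self _ _), hs⟩

theorem ZeroSumFree.coeff_augProd {S : Multiset G} (hS : ZeroSumFree S) :
    (augProd p S).coeff 0 = 1 := by
  induction S using Multiset.induction_on with
  | empty => simp [augProd]
  | cons g S ih =>
    rw [coeff_augProd_cons, ih fun T hT ↦ hS T (hT.trans (le_cons_self _ _)), sub_eq_self]
    by_contra h
    obtain ⟨T, hT, hs⟩ := exists_sum_eq_of_coeff_augProd_ne_zero h
    exact cons_ne_zero (hS (g ::ₘ T) ((cons_le_cons_iff _).2 hT) (by rw [sum_cons, hs]; abel))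

theorem AugNilpotent.mono {d e : ℕ} (h : AugNilpotent p G d) (hde : d ≤ e) :
    AugNilpotent p G e :=
  fun S hS ↦ h S (hde.trans hS)

theorem AugNilpotent.hasZeroSums (hp : p.Prime) {d : ℕ} (h : AugNilpotent p G d) :
    HasZeroSums G {t | 0 < t} d := by
  intro S hS
  by_contra! hT
  have : Fact p.Prime := ⟨hp⟩
  have hfree : ZeroSumFree S := fun T hTS hs ↦ by
    by_contra h0
    exact hT T hTS h0 hs (card_pos.2 h0)
  have := hfree.coeff_augProd (p := p)
  rw [h S hS] at this
  simp at this

theorem AugNilpotent.of_addEquiv {d : ℕ} (h : AugNilpotent p G d) (e : G ≃+ H) :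
    AugNilpotent p H d := by
  intro S hS
  have := map_augProd (p := p) (e : G →+ H) (S.map e.symm)
  rw [h _ (by simpa using hS), _root_.map_zero, Multiset.map_map] at this
  simpa using this.symm

/-- The Olson bound for the group algebra, one cyclic factor at a time. -/
theorem AugNilpotent.zmod_prod (hp : p.Prime) {d : ℕ} (h : AugNilpotent p G d) (k : ℕ) :
    AugNilpotent p (ZMod (p ^ k) × G) (p ^ k - 1 + d) := by
  have : Fact p.Prime := ⟨hp⟩
  have hpk : 0 < p ^ k := pow_pos hp.pos k
  have : NeZero (p ^ k) := ⟨hpk.ne'⟩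
  intro S hS
  let X : ZMod (p ^ k) × G → AddMonoidAlgebra (ZMod p) (ZMod (p ^ k) × G) :=
    fun g ↦ AddMonoidAlgebra.single g 1
  have : CharP (AddMonoidAlgebra (ZMod p) (ZMod (p ^ k) × G)) p :=
    charP_of_injective_ringHom
      (algebraMap (ZMod p) (AddMonoidAlgebra (ZMod p) (ZMod (p ^ k) × G))).injective p
  have hX : (1 - X (1, 0)) ^ p ^ k = 0 := by
    rw [sub_pow_char_pow, one_pow, AddMonoidAlgebra.single_pow, sub_eq_zero]
    simp [AddMonoidAlgebra.one_def, Prod.smul_mk, Prod.zero_eq_mk]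
  have hdvd : ∀ x : ZMod (p ^ k) × G, 1 - X (1, 0) ∣ 1 - X (x.1, 0) := by
    intro x
    have : X (x.1, 0) = X (1, 0) ^ x.1.val := by
      simp [X, AddMonoidAlgebra.single_pow]
    rw [this]
    exact one_sub_dvd_one_sub_pow _ _
  have hsplit : ∀ x : ZMod (p ^ k) × G,
      1 - X x = (1 - X (x.1, 0)) + X (x.1, 0) * (1 - X (0, x.2)) := by
    intro x
    have : X x = X (x.1, 0) * X (0, x.2) := by
      simp [X, AddMonoidAlgebra.single_mul_single]
    rw [this]
    ring
  have hexp : augProd p S = (S.map fun x ↦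
      (1 - X (x.1, 0)) + X (x.1, 0) * (1 - X (0, x.2))).prod :=
    congrArg _ (Multiset.map_congr rfl fun x _ ↦ hsplit x)
  rw [hexp, Multiset.prod_map_add]
  refine Multiset.sum_eq_zero fun y hy ↦ ?_
  obtain ⟨⟨A, B⟩, hAB, rfl⟩ := Multiset.mem_map.1 hy
  have hcard : card A + card B = card S := by
    rw [← card_add, mem_antidiagonal.1 hAB]
  rcases le_or_gt (p ^ k) (card A) with hA | hA
  · have h0 := (pow_dvd_pow _ hA).trans (pow_card_dvd_prod_map hdvd A)
    rw [hX, zero_dvd_iff] at h0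
    simp only [h0, zero_mul]
  · have h0 := map_augProd (p := p) (AddMonoidHom.inr (ZMod (p ^ k)) G) (B.map Prod.snd)
    rw [h _ (by rw [card_map]; omega), _root_.map_zero, Multiset.map_map] at h0
    have h1 : (B.map fun x ↦ 1 - X (0, x.2)).prod = 0 := by
      rw [h0, augProd, Multiset.map_map]
      rfl
    simp only [Multiset.prod_map_mul, h1, mul_zero]

end GroupAlgebra

section Structure

variable {p : ℕ} {G H : Type*} [AddCommGroup G] [AddCommGroup H]

theorem exists_pow_nsmul_eq_zero_of_injective (hG : ∀ g : G, ∃ k : ℕ, p ^ k • g = 0) {f : H →+ G}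
    (hf : Function.Injective f) (h : H) : ∃ k : ℕ, p ^ k • h = 0 := by
  obtain ⟨k, hk⟩ := hG (f h)
  rw [← _root_.map_nsmul] at hk
  exact ⟨k, (map_eq_zero_iff f hf).1 hk⟩

variable [Finite G]

theorem exists_exponent_eq_prime_pow (hp : p.Prime) (hG : ∀ g : G, ∃ k : ℕ, p ^ k • g = 0) :
    ∃ k, AddMonoid.exponent G = p ^ k := by
  obtain ⟨g, hg⟩ := AddMonoid.exists_addOrderOf_eq_exponent 
    (AddMonoid.ExponentExists.of_finite (G := G))
  obtain ⟨k, hk⟩ := hG g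
  obtain ⟨l, -, hl⟩ := (Nat.dvd_prime_pow hp).1 (addOrderOf_dvd_of_nsmul_eq_zero hk)
  exact ⟨l, hg ▸ hl⟩

/-- In a finite abelian `p`-group a cyclic subgroup of maximal order splits off. -/
theorem exists_addEquiv_zmod_exponent_prod (hp : p.Prime)
    (hG : ∀ g : G, ∃ k : ℕ, p ^ k • g = 0) :
    ∃ (H : Type) (_ : AddCommGroup H), Nonempty (G ≃+ ZMod (AddMonoid.exponent G) × H) := by
  classical
  obtain ⟨k, hk⟩ := exists_exponent_eq_prime_pow hp hG
  obtain ⟨ι, _, q, -, e, ⟨φ⟩⟩ := AddCommGroup.equiv_directSum_zmod_of_finite G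
  let ψ : G ≃+ (∀ i, ZMod (q i ^ e i)) := φ.trans (DirectSum.addEquivProd _)
  have hexp : AddMonoid.exponent G = Finset.univ.lcm fun i ↦ q i ^ e i := by
    rw [AddMonoid.exponent_eq_of_addEquiv ψ, AddMonoid.exponent_pi]
    simp only [ZMod.exponent]
  have hdvd : ∀ i, q i ^ e i ∣ AddMonoid.exponent G := fun i ↦
    hexp ▸ Finset.dvd_lcm (Finset.mem_univ i)
  have hpow : ∀ i, ∃ f, q i ^ e i = p ^ f := fun i ↦ by
    obtain ⟨f, -, hf⟩ := (Nat.dvd_prime_pow hp).1 (hk ▸ hdvd i)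
    exact ⟨f, hf⟩
  choose f hf using hpow
  rcases isEmpty_or_nonempty ι with hι | hι
  · have h1 : AddMonoid.exponent G = 1 := by simp [hexp]
    rw [h1]
    have : Subsingleton G := ψ.toEquiv.subsingleton
    exact ⟨PUnit, inferInstance, ⟨
      { toFun := fun _ ↦ 0
        invFun := fun _ ↦ 0
        left_inv := fun _ ↦ Subsingleton.elim _ _
        right_inv := fun _ ↦ Subsingleton.elim _ _
        map_add' := fun _ _ ↦ Subsingleton.elim _ _ }⟩⟩
  · obtain ⟨i, hi⟩ := Finite.exists_max f
    have hn : AddMonoid.exponent G = q i ^ e i := by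
      refine Nat.dvd_antisymm ?_ (hdvd i)
      rw [hexp]
      refine Finset.lcm_dvd fun j _ ↦ ?_
      rw [hf i, hf j]
      exact pow_dvd_pow _ (hi j)
    rw [hn]
    exact ⟨∀ j : {j // j ≠ i}, ZMod (q j ^ e j), inferInstance, ⟨ψ.trans
      { Equiv.piSplitAt i fun j ↦ ZMod (q j ^ e j) with
        map_add' := fun _ _ ↦ rfl }⟩⟩

end Structure

section Sequences

variable {p : ℕ} {G H : Type*} [AddCommGroup G] [AddCommGroup H]

theorem HasZeroSums.of_addEquiv {L : Set ℕ} {ℓ : ℕ} (h : HasZeroSums G L ℓ) (e : G ≃+ H) :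
    HasZeroSums H L ℓ := by
  intro S hS
  obtain ⟨T, hT, h0, hs, hL⟩ := h (S.map e.symm) (by simpa using hS)
  refine ⟨T.map e, ?_, by simpa using h0, ?_, by simpa using hL⟩
  · simpa [Multiset.map_map] using Multiset.map_le_map (f := e) hT
  · rw [← map_multiset_sum, hs, _root_.map_zero]

theorem zsInv_congr (e : G ≃+ H) (L : Set ℕ) : zsInv G L = zsInv H L := by
  have h : ∀ ℓ, HasZeroSums G L ℓ ↔ HasZeroSums H L ℓ := fun ℓ ↦
    ⟨fun h ↦ h.of_addEquiv e, fun h ↦ h.of_addEquiv e.symm⟩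
  change sInf {ℓ | 0 < ℓ ∧ HasZeroSums G L ℓ} = sInf {ℓ | 0 < ℓ ∧ HasZeroSums H L ℓ}
  simp only [h]

theorem zsInv_eq {L : Set ℕ} {ℓ : ℕ} (h : HasZeroSums G L (ℓ + 1)) {S : Multiset G}
    (hS : card S = ℓ) (hL : ∀ T ≤ S, T ≠ 0 → T.sum = 0 → card T ∉ L) :
    zsInv G L = ℓ + 1 := by
  refine le_antisymm (Nat.sInf_le ⟨Nat.succ_pos _, h⟩) (le_csInf ⟨_, Nat.succ_pos _, h⟩ ?_)
  rintro b ⟨-, hb⟩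
  by_contra! hlt
  obtain ⟨T, hT, h0, hs, hm⟩ := hb S (by omega)
  exact hL T hT h0 hs hm

theorem ZeroSumFree.map_addEquiv {S : Multiset G} (hS : ZeroSumFree S) (e : G ≃+ H) :
    ZeroSumFree (S.map e) := by
  intro T hT hs
  obtain ⟨U, hU, rfl⟩ := exists_le_map_eq_of_le_map _ hT
  rw [← map_multiset_sum, EmbeddingLike.map_eq_zero_iff] at hs
  rw [hS U hU hs, Multiset.map_zero]

/-- The sequence consisting of `m - 1` copies of a generator of the cyclic factor and of the
terms of `S`. -/
def cyclicExtension (m : ℕ) (S : Multiset H) : Multiset (ZMod m × H) :=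
  replicate (m - 1) (1, 0) + S.map fun t ↦ (0, t)

theorem card_cyclicExtension (m : ℕ) (S : Multiset H) :
    card (cyclicExtension m S) = m - 1 + card S := by
  simp [cyclicExtension]

theorem exists_of_le_cyclicExtension {m : ℕ} {S : Multiset H} {T : Multiset (ZMod m × H)}
    (hT : T ≤ cyclicExtension m S) : ∃ x ≤ m - 1, ∃ U ≤ S,
      T = replicate x (1, 0) + U.map fun t ↦ ((0 : ZMod m), t) := by
  obtain ⟨A, hA, B, hB, rfl⟩ := exists_eq_add_of_le_add_s1 hT
  obtain ⟨x, hx, rfl⟩ := le_replicate_iff.1 hA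
  obtain ⟨U, hU, rfl⟩ := exists_le_map_eq_of_le_map _ hB
  exact ⟨x, hx, U, hU, rfl⟩

theorem sum_map_prodMk (c : G) (U : Multiset H) :
    (U.map fun t ↦ (c, t)).sum = (card U • c, U.sum) := by
  induction U using Multiset.induction_on with
  | empty => simp [Prod.zero_eq_mk]
  | cons a U ih => simp [ih, add_smul, add_comm]

theorem ZeroSumFree.cyclicExtension {S : Multiset H} (hS : ZeroSumFree S) {m : ℕ} (hm : 0 < m) :
    ZeroSumFree (cyclicExtension m S) := by
  intro T hT hs
  obtain ⟨x, hx, U, hU, rfl⟩ := exists_of_le_cyclicExtension hT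
  rw [sum_add, sum_map_prodMk, sum_replicate, Prod.ext_iff] at hs
  simp only [Prod.smul_mk, Prod.mk_add_mk, nsmul_eq_mul, mul_one, add_zero, smul_zero,
    zero_add, Prod.fst_zero, Prod.snd_zero] at hs
  have hx0 : x = 0 :=
    Nat.eq_zero_of_dvd_of_lt ((ZMod.natCast_eq_zero_iff _ _).1 hs.1) (by omega)
  rw [hx0, hS U hU hs.2]
  simp

/-- If `S` is zero-sum free over `H`, then `(1, 0)^(m-1)`, `(0, t)` and `(1, t)` for `t` in `S`
have no short zero-sum subsequence. -/
theorem ZeroSumFree.lt_card_of_le_cyclicExtension_add {S : Multiset H} (hS : ZeroSumFree S) {m : ℕ}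
    (hm : 0 < m) {T : Multiset (ZMod m × H)}
    (hT : T ≤ _root_.cyclicExtension m S + S.map fun t ↦ (1, t)) (h0 : T ≠ 0) (hs : T.sum = 0) :
    m < card T := by
  obtain ⟨A, hA, B, hB, rfl⟩ := exists_eq_add_of_le_add_s1 hT
  obtain ⟨x, hx, U, hU, rfl⟩ := exists_of_le_cyclicExtension hA
  obtain ⟨V, hV, rfl⟩ := exists_le_map_eq_of_le_map _ hB
  rw [sum_add, sum_add, sum_map_prodMk, sum_map_prodMk, sum_replicate, Prod.ext_iff] at hs
  simp only [Prod.smul_mk, Prod.mk_add_mk, nsmul_eq_mul, mul_one, add_zero, smul_zero,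
    zero_add, Prod.fst_zero, Prod.snd_zero] at hs
  obtain ⟨hs1, hs2⟩ := hs
  rw [← Nat.cast_add, ZMod.natCast_eq_zero_iff] at hs1
  simp only [card_add, card_replicate, card_map]
  by_contra! hle
  by_cases hxV : x + card V = 0
  · have hV0 : V = 0 := card_eq_zero.1 (by omega)
    have hx0 : x = 0 := by omega
    subst hV0 hx0
    rw [sum_zero, add_zero] at hs2
    exact h0 (by simp [hS U hU hs2])
  · have hm' := Nat.le_of_dvd (by omega) hs1
    have hU0 : U = 0 := card_eq_zero.1 (by omega)
    subst hU0
    rw [sum_zero, zero_add] at hs2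
    have hV0 := hS V hV hs2
    subst hV0
    rw [card_zero] at hm'
    omega

/-- A finite abelian `p`-group has a zero-sum free sequence whose length is only one less than a
nilpotency bound for the group algebra. -/
theorem exists_zeroSumFree_augNilpotent (hp : p.Prime) (G : Type*) [AddCommGroup G] [Finite G]
    (hG : ∀ g : G, ∃ k : ℕ, p ^ k • g = 0) :
    ∃ S : Multiset G, ZeroSumFree S ∧ AugNilpotent p G (card S + 1) := by
  have key : ∀ (N : ℕ) (G : Type) [AddCommGroup G] [Finite G], Nat.card G = N →
      (∀ g : G, ∃ k : ℕ, p ^ k • g = 0) →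
      ∃ S : Multiset G, ZeroSumFree S ∧ AugNilpotent p G (card S + 1) := by
    intro N
    induction N using Nat.strong_induction_on with
    | _ N ih =>
    intro G _ _ hN hG
    rcases subsingleton_or_nontrivial G with hsub | hnt
    · refine ⟨0, fun T hT _ ↦ by simpa using hT, fun S hS ↦ ?_⟩
      obtain ⟨g, hg⟩ := card_pos_iff_exists_mem.1 (Nat.zero_lt_of_lt hS)
      obtain ⟨S, rfl⟩ := exists_cons_of_mem hg
      rw [augProd_cons, Subsingleton.elim g 0, ← AddMonoidAlgebra.one_def, sub_self, zero_mul]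
    · obtain ⟨k, hk⟩ := exists_exponent_eq_prime_pow hp hG
      obtain ⟨H, _, ⟨e⟩⟩ := exists_addEquiv_zmod_exponent_prod hp hG
      have hlt : 1 < AddMonoid.exponent G := AddMonoid.one_lt_exponent
      rw [hk] at e hlt
      have : Finite (ZMod (p ^ k) × H) := Finite.of_equiv _ e.toEquiv
      have : Finite H := Finite.of_surjective (Prod.snd : ZMod (p ^ k) × H → H) Prod.snd_surjective
      have hcard : N = p ^ k * Nat.card H := by
        rw [← hN, Nat.card_congr e.toEquiv, Nat.card_prod, Nat.card_zmod]
      have hHpos : 0 < Nat.card H := Nat.card_pos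
      obtain ⟨S, hS, hA⟩ := ih (Nat.card H) (by nlinarith) H rfl
        (exists_pow_nsmul_eq_zero_of_injective hG
          (f := (e.symm : ZMod (p ^ k) × H →+ G).comp (AddMonoidHom.inr _ _))
          (e.symm.injective.comp (Prod.mk_right_injective 0)))
      refine ⟨(cyclicExtension (p ^ k) S).map e.symm,
        (hS.cyclicExtension (by omega)).map_addEquiv e.symm, ?_⟩
      rw [card_map, card_cyclicExtension, add_assoc]
      exact (hA.zmod_prod hp k).of_addEquiv e.symm
  have e : Shrink.{0} G ≃+ G := Shrink.addEquiv
  have : Finite (Shrink.{0} G) := Finite.of_equiv _ e.symm.toEquiv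
  obtain ⟨S, hS, hA⟩ := key _ (Shrink.{0} G) rfl
    (exists_pow_nsmul_eq_zero_of_injective hG (f := (e : Shrink.{0} G →+ G)) e.injective)
  exact ⟨S.map e, hS.map_addEquiv e, by simpa using hA.of_addEquiv e⟩

end Sequences

section UpperBounds

variable {n s a N : ℕ} {K M : Type*} [AddCommGroup K] [AddCommGroup M]

theorem hasZeroSums_zmod (ha : 0 < a) : HasZeroSums (ZMod a) {t | 0 < t} a := by
  intro S hS
  obtain ⟨T, hT, hcard, hsum⟩ := ZMod.erdos_ginzburg_ziv_multiset (S + replicate (a - 1) 0)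
    (by rw [card_add, card_replicate]; omega)
  obtain ⟨A, hA, B, hB, rfl⟩ := exists_eq_add_of_le_add_s1 hT
  obtain ⟨x, hx, rfl⟩ := le_replicate_iff.1 hB
  rw [card_add, card_replicate] at hcard
  have hApos : 0 < card A := by omega
  exact ⟨A, hA, card_pos.1 hApos, by simpa using hsum, hApos⟩

/-- The bound `η(K) ≤ 2 D(K) - n` in terms of `D(K) = n + s`. -/
theorem hasZeroSums_short (hn : s + 1 ≤ n) (hK : HasZeroSums K {t | 0 < t} (n + s))
    (hnK : HasZeroSums (ZMod n × K) {t | 0 < t} (n - 1 + (n + s))) :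
    HasZeroSums K {t | 0 < t ∧ t ≤ n} (n + 2 * s) := by
  intro S' hS'
  obtain ⟨S, hSS', hS⟩ := exists_le_card_eq_of_le_card_s1 hS'
  obtain ⟨T', hT', h0, hs, -⟩ := hnK
    ((S + replicate (n - 1 - s) 0).map fun g ↦ ((1 : ZMod n), g))
    (by rw [card_map, card_add, card_replicate]; omega)
  obtain ⟨T, hT, rfl⟩ := exists_le_map_eq_of_le_map _ hT'
  rw [sum_map_prodMk, Prod.ext_iff] at hs
  simp only [nsmul_eq_mul, mul_one, Prod.fst_zero, Prod.snd_zero] at hs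
  obtain ⟨c, hc⟩ := (ZMod.natCast_eq_zero_iff _ _).1 hs.1
  have hTpos : 0 < card T := by
    rw [← card_map fun g ↦ ((1 : ZMod n), g)]
    exact card_pos.2 h0
  have hTle := card_le_card hT
  obtain ⟨A, hA, B, hB, rfl⟩ := exists_eq_add_of_le_add_s1 hT
  obtain ⟨x, hx, rfl⟩ := le_replicate_iff.1 hB
  have hAsum : A.sum = 0 := by simpa using hs.2
  simp only [card_add, card_replicate] at hc hTpos hTle
  have hc3 : c < 3 := by
    by_contra! hc3
    have := Nat.mul_le_mul_left n hc3
    omega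
  have hASle := hA.trans hSS'
  interval_cases c
  · omega
  · exact ⟨A, hASle, card_pos.1 (by omega), hAsum, by omega, by omega⟩
  · obtain ⟨A', hA', hcard⟩ := exists_le_card_eq_of_le_card_s1 (S := A) (n := n + s) (by omega)
    obtain ⟨T, hTA', hT0, hTs, hT1⟩ := hK A' hcard.ge
    obtain ⟨U, rfl⟩ := Multiset.le_iff_exists_add.1 (hTA'.trans hA')
    have hTle := card_le_card hTA'
    rw [card_add] at hc
    rw [sum_add, hTs, zero_add] at hAsum
    rcases le_or_gt (card T) n with h | h
    · exact ⟨T, (le_add_right _ _).trans hASle, hT0, hTs, hT1, h⟩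
    · have hUpos : 0 < card U := by omega
      exact ⟨U, (le_add_left _ _).trans hASle, card_pos.1 hUpos, hAsum, hUpos, by omega⟩

theorem exists_blocks (f : M →+ K) (h : HasZeroSums K {t | 0 < t ∧ t ≤ n} N) (j : ℕ)
    (S : Multiset M) (hS : j * n + N ≤ card S + n) :
    ∃ B : Multiset (Multiset M), card B = j ∧ B.sum ≤ S ∧
      ∀ b ∈ B, b ≠ 0 ∧ f b.sum = 0 ∧ card b ≤ n := by
  induction j generalizing S with
  | zero => exact ⟨0, by simp⟩
  | succ j ih =>
    rw [add_mul, one_mul] at hS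
    obtain ⟨T', hT', h0, hs, -, hle⟩ := h (S.map f) (by rw [card_map]; omega)
    obtain ⟨T, hT, rfl⟩ := exists_le_map_eq_of_le_map _ hT'
    obtain ⟨U, rfl⟩ := Multiset.le_iff_exists_add.1 hT
    rw [card_map] at hle
    rw [card_add] at hS
    obtain ⟨B, hcard, hB, hb⟩ := ih U (by omega)
    refine ⟨T ::ₘ B, by simp [hcard], ?_, ?_⟩
    · rw [sum_cons]
      gcongr
    · rintro b hb'
      rcases mem_cons.1 hb' with rfl | hb'
      · exact ⟨fun h ↦ h0 (by rw [h, Multiset.map_zero]), by rw [map_multiset_sum, hs], hle⟩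
      · exact hb b hb'

theorem exists_le_sum_eq_zero_of_blocks (ha : 0 < a) {B : Multiset (Multiset (ZMod a × K))}
    (hcard : a ≤ card B) (hB : ∀ b ∈ B, b ≠ 0 ∧ b.sum.2 = 0) :
    ∃ C ≤ B, C.sum ≠ 0 ∧ C.sum.sum = 0 := by
  obtain ⟨C', hC', h0, hs, -⟩ := hasZeroSums_zmod ha (B.map fun b ↦ b.sum.1) (by simpa using hcard)
  obtain ⟨C, hC, rfl⟩ := exists_le_map_eq_of_le_map _ hC'
  have hsum : C.sum.sum = (C.map Multiset.sum).sum := by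
    exact sum_join
  refine ⟨C, hC, fun h ↦ ?_, ?_⟩
  · have hne : C ≠ 0 := fun h ↦ h0 (by rw [h, Multiset.map_zero])
    obtain ⟨b, hb⟩ := exists_mem_of_ne_zero hne
    have hle : b ≤ C.sum := single_le_sum (fun _ _ ↦ zero_le _) b hb
    exact (hB b (mem_of_le hC hb)).1 (le_zero.1 (h ▸ hle))
  · rw [hsum]
    refine Prod.ext ?_ ?_
    · have := map_multiset_sum (AddMonoidHom.fst (ZMod a) K) (C.map Multiset.sum)
      rw [Multiset.map_map] at this
      exact this.trans hs
    · have := map_multiset_sum (AddMonoidHom.snd (ZMod a) K) (C.map Multiset.sum)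
      rw [Multiset.map_map] at this
      refine this.trans (sum_eq_zero fun x hx ↦ ?_)
      obtain ⟨b, hb, rfl⟩ := Multiset.mem_map.1 hx
      exact (hB b (mem_of_le hC hb)).2

theorem hasZeroSums_short_zmod_prod (ha : 0 < a)
    (hK : HasZeroSums K {t | 0 < t ∧ t ≤ n} (n + 2 * s)) :
    HasZeroSums (ZMod a × K) {t | 0 < t ∧ t ≤ a * n} (a * n + 2 * s) := by
  intro S hS
  obtain ⟨B, hcard, hBS, hB⟩ := exists_blocks (AddMonoidHom.snd (ZMod a) K) hK a S (by omega)
  obtain ⟨C, hC, h0, hs⟩ := exists_le_sum_eq_zero_of_blocks ha hcard.ge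
    fun b hb ↦ ⟨(hB b hb).1, (hB b hb).2.1⟩
  have hCB : C.sum ≤ B.sum := multiset_sum_mono hC
  refine ⟨C.sum, hCB.trans hBS, h0, hs, card_pos.2 h0, (card_le_card hCB).trans ?_⟩
  have hB' := card_sum_le fun b hb ↦ (hB b hb).2.2
  rwa [hcard] at hB'

theorem hasZeroSums_zmod_prod (ha : 0 < a) (hs : s ≤ n)
    (hK : HasZeroSums K {t | 0 < t} (n + s))
    (hK' : HasZeroSums K {t | 0 < t ∧ t ≤ n} (n + 2 * s)) :
    HasZeroSums (ZMod a × K) {t | 0 < t} (a * n + s) := by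
  obtain ⟨j, rfl⟩ := Nat.exists_eq_add_one.2 ha
  intro S hS
  rw [add_mul, one_mul] at hS
  obtain ⟨B, hcard, hBS, hB⟩ := exists_blocks (AddMonoidHom.snd (ZMod (j + 1)) K) hK' j S (by omega)
  obtain ⟨U, rfl⟩ := Multiset.le_iff_exists_add.1 hBS
  have hcs : card B.sum ≤ j * n := by
    have hB' := card_sum_le fun b hb ↦ (hB b hb).2.2
    rwa [hcard] at hB'
  rw [card_add] at hS
  obtain ⟨T', hT', h0, hs, -⟩ := hK (U.map Prod.snd) (by rw [card_map]; omega)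
  obtain ⟨T, hT, rfl⟩ := exists_le_map_eq_of_le_map _ hT'
  obtain ⟨C, hC, h0', hs'⟩ := exists_le_sum_eq_zero_of_blocks (B := T ::ₘ B) ha
    (by rw [card_cons, hcard]) (by
      rintro b hb
      rcases mem_cons.1 hb with rfl | hb
      · exact ⟨fun h ↦ h0 (by rw [h, Multiset.map_zero]),
          (map_multiset_sum (AddMonoidHom.snd (ZMod (j + 1)) K) b).trans hs⟩
      · exact ⟨(hB b hb).1, (hB b hb).2.1⟩)
  refine ⟨C.sum, ?_, h0', hs', card_pos.2 h0'⟩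
  refine (multiset_sum_mono hC).trans ?_
  rw [sum_cons, add_comm T]
  gcongr

end UpperBounds

/-- For a finite abelian `p`-group `G` with `D(G) ≤ 2·exp(G) − 1` and a
positive integer `a` not divisible by `p`, the group `G' = C_a ⊕ G` satisfies
`2·D(G') − 1 = η(G') + exp(G') − 1`; equivalently, `η(G') = 2·D(G') − exp(G')`. -/
theorem stmt1 (p : ℕ) (hp : p.Prime) (G : Type*) [AddCommGroup G] [Finite G]
    (hpG : ∀ g : G, ∃ k : ℕ, p ^ k • g = 0)
    (hD : davenport G ≤ 2 * AddMonoid.exponent G - 1)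
    (a : ℕ) (ha : 0 < a) (hpa : ¬ p ∣ a) :
    2 * davenport (ZMod a × G) - 1 =
        etaInv (ZMod a × G) + AddMonoid.exponent (ZMod a × G) - 1 ∧
      etaInv (ZMod a × G) =
        2 * davenport (ZMod a × G) - AddMonoid.exponent (ZMod a × G) := by
  obtain ⟨k, hk⟩ := exists_exponent_eq_prime_pow hp hpG
  obtain ⟨H, _, ⟨e⟩⟩ := exists_addEquiv_zmod_exponent_prod hp hpG
  set n := AddMonoid.exponent G with hn
  have hn0 : 0 < n := hk ▸ pow_pos hp.pos k
  have : NeZero n := ⟨hn0.ne'⟩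
  have : Finite (ZMod n × H) := Finite.of_equiv _ e.toEquiv
  have : Finite H := Finite.of_surjective (Prod.snd : ZMod n × H → H) Prod.snd_surjective
  obtain ⟨S, hS, hA⟩ := exists_zeroSumFree_augNilpotent hp H
    (exists_pow_nsmul_eq_zero_of_injective hpG
      (f := (e.symm : ZMod n × H →+ G).comp (AddMonoidHom.inr _ _))
      (e.symm.injective.comp (Prod.mk_right_injective 0)))
  have hA' : AugNilpotent p (ZMod n × H) (n + card S) := by
    have := hA.zmod_prod hp k
    rw [← hk] at this
    exact this.mono (by omega)
  have hA'' : AugNilpotent p (ZMod n × (ZMod n × H)) (n - 1 + (n + card S)) := by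
    have := hA'.zmod_prod hp k
    rwa [← hk] at this
  have hDK : ∀ m, 0 < m → HasZeroSums (ZMod m × H) {t | 0 < t} (m + card S) →
      davenport (ZMod m × H) = m + card S := by
    intro m hm hz
    have hm' : m + card S = m - 1 + card S + 1 := by omega
    rw [hm'] at hz ⊢
    exact zsInv_eq hz (card_cyclicExtension m S) fun T hT h0 hs ↦
      absurd (hS.cyclicExtension hm T hT hs) h0
  have hDG : davenport G = n + card S := (zsInv_congr e _).trans (hDK n hn0 (hA'.hasZeroSums hp))
  have hsn : card S + 1 ≤ n := by omega
  have hshort := hasZeroSums_short hsn (hA'.hasZeroSums hp) (hA''.hasZeroSums hp)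
  have hcop : Nat.Coprime a n := by
    rw [hk]
    exact Nat.Coprime.pow_right _ ((Nat.Prime.coprime_iff_not_dvd hp).2 hpa).symm
  let φ : ZMod a × (ZMod n × H) ≃+ ZMod (a * n) × H :=
    AddEquiv.prodAssoc.symm.trans
      ((ZMod.chineseRemainder hcop).symm.toAddEquiv.prodCongr (AddEquiv.refl H))
  let ψ : ZMod a × G ≃+ ZMod (a * n) × H := ((AddEquiv.refl _).prodCongr e).trans φ
  have hm : 0 < a * n := Nat.mul_pos ha hn0
  have hD' : davenport (ZMod a × G) = a * n + card S :=
    (zsInv_congr ψ _).trans (hDK _ hm ((hasZeroSums_zmod_prod ha (by omega)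
      (hA'.hasZeroSums hp) hshort).of_addEquiv φ))
  have hexp : AddMonoid.exponent (ZMod a × G) = a * n := by
    rw [AddMonoid.exponent_prod, ZMod.exponent]
    exact hcop.lcm_eq_mul
  have hη : etaInv (ZMod a × G) = a * n + 2 * card S := by
    rw [etaInv, hexp, zsInv_congr ψ]
    have hz := (hasZeroSums_short_zmod_prod ha hshort).of_addEquiv φ
    have hm' : a * n + 2 * card S = a * n - 1 + 2 * card S + 1 := by omega
    rw [hm'] at hz ⊢
    refine zsInv_eq hz (S := cyclicExtension (a * n) S + S.map fun t ↦ (1, t)) ?_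
      fun T hT h0 hs hL ↦ ?_
    · rw [card_add, card_cyclicExtension, card_map]
      omega
    · exact absurd hL.2 (hS.lt_card_of_le_cyclicExtension_add hm hT h0 hs).not_ge
  rw [hD', hη, hexp]
  omega
end

section
/- Let p be a prime, let G be a finite abelian p-group, and let n = exp(G). For every integer i with 1 ≤ i ≤ n, ζ_i(G) = D(G) + i − 1. -/
theorem zsInv_eq_succ {G : Type*} [AddCommGroup G] {L : Set ℕ} {ℓ : ℕ}
    (h : ∀ S : Multiset G, ℓ + 1 ≤ Multiset.card S →
      ∃ T : Multiset G, T ≤ S ∧ T ≠ 0 ∧ T.sum = 0 ∧ Multiset.card T ∈ L)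
    {S : Multiset G} (hcard : Multiset.card S = ℓ)
    (hS : ∀ T ≤ S, T ≠ 0 → T.sum = 0 → Multiset.card T ∉ L) :
    zsInv G L = ℓ + 1 := by
  refine le_antisymm (Nat.sInf_le ⟨Nat.succ_pos _, h⟩)
    (le_csInf ⟨_, Nat.succ_pos _, h⟩ ?_)
  rintro m ⟨-, hm⟩
  by_contra! hlt
  obtain ⟨T, hT, h0, hsum, hL⟩ := hm S (by omega)
  exact hS T hT h0 hsum hL

theorem Ideal.sum_pow_eq_bot {R ι : Type*} [CommRing R] (s : Finset ι) (I : ι → Ideal R)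
    (d : ι → ℕ) (h : ∀ j ∈ s, I j ^ (d j + 1) = 0) :
    (∑ j ∈ s, I j) ^ (∑ j ∈ s, d j + 1) = 0 := by
  classical
  induction s using Finset.induction_on with
  | empty => simp
  | insert a s ha ih =>
    rw [Finset.sum_insert ha, Finset.sum_insert ha]
    refine (Commute.all _ _).add_pow_eq_zero_of_add_le_succ_of_pow_eq_zero
      (h a (by simp)) (ih fun j hj ↦ h j (by simp [hj])) ?_
    omega

/-- In characteristic `p`, the group algebra elements `1 - X ^ h` generate a nilpotent ideal,
whose nilpotency index is controlled by the orders of a generating family. -/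
theorem prod_one_sub_single_eq_zero {p : ℕ} [Fact p.Prime] {H ι : Type*} [AddCommGroup H]
    [Fintype ι] (e : ι → H) (k : ι → ℕ) (he : ∀ j, p ^ k j • e j = 0)
    (hgen : AddSubgroup.closure (Set.range e) = ⊤) {κ : Type*} (s : Finset κ) (h : κ → H)
    (hs : ∑ j, (p ^ k j - 1) + 1 ≤ s.card) :
    ∏ x ∈ s, (1 - AddMonoidAlgebra.single (h x) 1 : AddMonoidAlgebra (ZMod p) H) = 0 := by
  let X : H → AddMonoidAlgebra (ZMod p) H := fun g ↦ AddMonoidAlgebra.single g 1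
  have hX0 : X 0 = 1 := rfl
  have hXadd (a b : H) : X (a + b) = X a * X b := by
    simp [X, AddMonoidAlgebra.single_mul_single]
  have hXpow (a : H) (m : ℕ) : X a ^ m = X (m • a) := by
    simp [X, AddMonoidAlgebra.single_pow]
  let I : Ideal (AddMonoidAlgebra (ZMod p) H) := ∑ j, Ideal.span {1 - X (e j)}
  have hI : I ^ (∑ j, (p ^ k j - 1) + 1) = 0 := by
    refine Ideal.sum_pow_eq_bot _ _ _ fun j _ ↦ ?_
    have hp : 0 < p ^ k j := pow_pos (Fact.out : p.Prime).pos _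
    have : CharP (AddMonoidAlgebra (ZMod p) H) p :=
      charP_of_injective_algebraMap (algebraMap (ZMod p) _).injective p
    rw [Nat.sub_add_cancel hp, Ideal.span_singleton_pow, sub_pow_char_pow, hXpow, he, hX0]
    simp
  have hmem (g : H) : 1 - X g ∈ I := by
    have hg : g ∈ AddSubgroup.closure (Set.range e) := hgen ▸ AddSubgroup.mem_top g
    induction hg using AddSubgroup.closure_induction with
    | mem x hx =>
      obtain ⟨j, rfl⟩ := hx
      exact (Finset.single_le_sum (f := fun j ↦ Ideal.span {1 - X (e j)})
        (fun _ _ ↦ zero_le) (Finset.mem_univ j)) (Ideal.mem_span_singleton_self _)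
    | zero => simp [hX0]
    | add x y _ _ hx hy =>
      have : 1 - X (x + y) = (1 - X x) + X x * (1 - X y) := by rw [hXadd]; ring
      rw [this]
      exact I.add_mem hx (I.mul_mem_left _ hy)
    | neg x _ hx =>
      have hxx : X (-x) * X x = 1 := by rw [← hXadd, neg_add_cancel, hX0]
      have : 1 - X (-x) = -X (-x) * (1 - X x) := by linear_combination -hxx
      rw [this]
      exact I.mul_mem_left _ hx
  have hprod : ∏ x ∈ s, (1 - X (h x)) ∈ ∏ _x ∈ s, I :=
    Ideal.prod_mem_prod fun x _ ↦ hmem (h x)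
  rw [Finset.prod_const] at hprod
  have := Ideal.pow_le_pow_right hs hprod
  rwa [hI] at this

/-- Upper bound in Olson's theorem on the Davenport constant of a finite abelian `p`-group. -/
theorem exists_zero_sum_of_generators {p : ℕ} [Fact p.Prime] {H ι : Type*} [AddCommGroup H]
    [Fintype ι] (e : ι → H) (k : ι → ℕ) (he : ∀ j, p ^ k j • e j = 0)
    (hgen : AddSubgroup.closure (Set.range e) = ⊤) {κ : Type*} (s : Finset κ) (h : κ → H)
    (hs : ∑ j, (p ^ k j - 1) + 1 ≤ s.card) :
    ∃ t ⊆ s, t.Nonempty ∧ ∑ x ∈ t, h x = 0 := by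
  classical
  by_contra! hno
  have hprod := prod_one_sub_single_eq_zero e k he hgen s h hs
  simp only [sub_eq_add_neg] at hprod
  rw [Finset.prod_one_add] at hprod
  have hterm (t : Finset κ) : ∏ x ∈ t, (-AddMonoidAlgebra.single (h x) 1 :
      AddMonoidAlgebra (ZMod p) H) =
      (AddMonoidAlgebra.single (∑ x ∈ t, h x) ((-1) ^ t.card)) := by
    induction t using Finset.induction_on with
    | empty => simp [AddMonoidAlgebra.one_def]
    | insert a t ha ih =>
      rw [Finset.prod_insert ha, ih, Finset.sum_insert ha, Finset.card_insert_of_notMem ha,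
        neg_mul, AddMonoidAlgebra.single_mul_single, pow_succ', one_mul, neg_one_mul]
      simp
  simp only [hterm] at hprod
  rw [← Finset.add_sum_erase _ _ (Finset.empty_mem_powerset s)] at hprod
  have hcoeff := congrArg (fun x : AddMonoidAlgebra (ZMod p) H ↦ x.coeff 0) hprod
  have hrest : ∀ t ∈ s.powerset.erase ∅,
      (AddMonoidAlgebra.single (∑ x ∈ t, h x) ((-1) ^ t.card) :
        AddMonoidAlgebra (ZMod p) H).coeff 0 = 0 := by
    intro t ht
    rw [Finset.mem_erase, Finset.mem_powerset] at ht
    have := hno t ht.2 (Finset.nonempty_iff_ne_empty.2 ht.1)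
    simp [this]
  simp only [AddMonoidAlgebra.coeff_add, AddMonoidAlgebra.coeff_sum, Finsupp.add_apply,
    Finsupp.finsetSum_apply, Finset.sum_eq_zero hrest] at hcoeff
  simp at hcoeff

theorem exists_map_eq_of_le_map {α β : Type*} {f : α → β} {s : Multiset α} {t : Multiset β}
    (h : t ≤ s.map f) : ∃ u ≤ s, u.map f = t := by
  classical
  induction s using Multiset.induction_on generalizing t with
  | empty => exact ⟨0, le_rfl, by simpa [eq_comm] using h⟩
  | cons a s ih =>
    rw [Multiset.map_cons] at h
    by_cases ha : f a ∈ t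
    · obtain ⟨u, hu, hut⟩ := ih (Multiset.erase_le_iff_le_cons.2 h)
      exact ⟨a ::ₘ u, Multiset.cons_le_cons a hu, by
        rw [Multiset.map_cons, hut, Multiset.cons_erase ha]⟩
    · obtain ⟨u, hu, hut⟩ := ih ((Multiset.le_cons_of_notMem ha).1 h)
      exact ⟨u, hu.trans (Multiset.le_cons_self _ _), hut⟩

theorem exists_add_eq_of_le_add {α : Type*} {s t u : Multiset α} (h : u ≤ s + t) :
    ∃ a ≤ s, ∃ b ≤ t, a + b = u := by
  classical
  exact ⟨u ∩ s, Multiset.inter_le_right, u - s, tsub_le_iff_left.2 h, by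
    rw [add_comm, Multiset.sub_add_inter]⟩

/-- Lower bound for the Davenport constant: an independent family yields a zero-sum free
sequence. -/
theorem exists_zero_sum_free_of_independent {G ι : Type*} [AddCommGroup G] [Fintype ι]
    (e : ι → G) (o : ι → ℕ) (ho : ∀ j, 0 < o j)
    (hind : ∀ c : ι → ℕ, ∑ j, c j • e j = 0 → ∀ j, o j ∣ c j) :
    ∃ S : Multiset G, Multiset.card S = ∑ j, (o j - 1) ∧ ∀ T ≤ S, T.sum = 0 → T = 0 := by
  classical
  refine ⟨(∑ j, Multiset.replicate (o j - 1) j).map e, by simp, fun T hT hsum ↦ ?_⟩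
  obtain ⟨U, hU, rfl⟩ := exists_map_eq_of_le_map hT
  have hcount (j : ι) : U.count j ≤ o j - 1 := by
    refine (Multiset.count_le_of_le j hU).trans_eq ?_
    rw [Multiset.count_sum']
    simp [Multiset.count_replicate]
  have hsum' : ∑ j, U.count j • e j = 0 := by
    rw [← hsum, Finset.sum_multiset_map_count]
    refine (Finset.sum_subset (Finset.subset_univ _) fun j _ hj ↦ ?_).symm
    rw [Multiset.count_eq_zero.2 (by simpa using hj), zero_smul]
  have hU0 : U = 0 := by
    refine Multiset.eq_zero_of_forall_notMem fun j hj ↦ ?_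
    have h1 := Nat.le_of_dvd (Multiset.count_pos.2 hj) (hind _ hsum' j)
    have h2 := hcount j
    have h3 := ho j
    omega
  rw [hU0, Multiset.map_zero]

theorem exists_independent_generators {p : ℕ} (hp : p.Prime) (G : Type*) [AddCommGroup G]
    [Finite G] (hpG : ∀ g : G, ∃ k : ℕ, p ^ k • g = 0) :
    ∃ (ι : Type) (_ : Fintype ι) (e : ι → G) (k : ι → ℕ),
      (∀ j, p ^ k j • e j = 0) ∧ AddSubgroup.closure (Set.range e) = ⊤ ∧
      ∀ c : ι → ℕ, ∑ j, c j • e j = 0 → ∀ j, p ^ k j ∣ c j := by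
  classical
  obtain ⟨ι, hι, q, hq, a, ⟨f⟩⟩ := AddCommGroup.equiv_directSum_zmod_of_finite G
  let e : ι → G := fun j ↦ f.symm (DirectSum.of (fun i ↦ ZMod (q i ^ a i)) j 1)
  have hsmul (m : ℕ) (j : ι) :
      f (m • e j) = DirectSum.of (fun i ↦ ZMod (q i ^ a i)) j (m : ZMod (q j ^ a j)) := by
    rw [map_nsmul, AddEquiv.apply_symm_apply, ← map_nsmul, nsmul_one]
  have hzero (m : ℕ) (j : ι) : m • e j = 0 ↔ q j ^ a j ∣ m := by
    rw [← f.map_eq_zero_iff, hsmul, ← ZMod.natCast_eq_zero_iff]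
    exact map_eq_zero_iff _ (DirectSum.of_injective j)
  have hk (j : ι) : ∃ k, q j ^ a j = p ^ k := by
    obtain ⟨m, hm⟩ := hpG (e j)
    obtain ⟨k, -, hk⟩ := (Nat.dvd_prime_pow hp).1 ((hzero _ j).1 hm)
    exact ⟨k, hk⟩
  choose k hk using hk
  refine ⟨ι, hι, e, k, fun j ↦ (hzero _ j).2 (hk j).dvd, ?_, fun c hc j ↦ ?_⟩
  · rw [eq_top_iff]
    intro g _
    obtain ⟨x, rfl⟩ := f.symm.surjective g
    induction x using DirectSum.induction_on with
    | zero => simp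
    | of j x =>
      have : NeZero (q j ^ a j) := ⟨pow_ne_zero _ (hq j).ne_zero⟩
      have : f.symm (DirectSum.of (fun i ↦ ZMod (q i ^ a i)) j x) = x.val • e j := by
        rw [AddEquiv.symm_apply_eq, hsmul, ZMod.natCast_zmod_val]
      rw [this]
      exact AddSubgroup.nsmul_mem _ (AddSubgroup.subset_closure (Set.mem_range_self j)) _
    | add x y hx hy =>
      rw [map_add]
      exact AddSubgroup.add_mem _ (hx trivial) (hy trivial)
  · have hfc := congrArg (fun x ↦ f x j) hc
    simp only [map_sum, hsmul, map_zero] at hfc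
    rw [← hk, ← ZMod.natCast_eq_zero_iff]
    refine Eq.trans ?_ hfc
    rw [DFinsupp.finsetSum_apply, Finset.sum_eq_single j]
    · exact (DirectSum.of_eq_same (β := fun i ↦ ZMod (q i ^ a i)) j _).symm
    · exact fun i _ hij ↦
        DirectSum.of_eq_of_ne (β := fun i ↦ ZMod (q i ^ a i)) _ _ _ hij.symm
    · simp

theorem exists_zero_sum_submultiset {p : ℕ} [Fact p.Prime] {H ι : Type*} [AddCommGroup H]
    [Fintype ι] (e : ι → H) (k : ι → ℕ) (he : ∀ j, p ^ k j • e j = 0)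
    (hgen : AddSubgroup.closure (Set.range e) = ⊤) (S : Multiset H)
    (hS : ∑ j, (p ^ k j - 1) + 1 ≤ Multiset.card S) :
    ∃ T ≤ S, T ≠ 0 ∧ T.sum = 0 := by
  induction S using Quotient.inductionOn with
  | _ l =>
  have hl : (Finset.univ.val.map l.get : Multiset H) = (l : Multiset H) := by
    rw [Fin.univ_val_map, List.ofFn_get]
  obtain ⟨t, -, ht, hsum⟩ := exists_zero_sum_of_generators e k he hgen Finset.univ l.get
    (by simpa using hS)
  refine ⟨t.val.map l.get, ?_, by simpa using ht.ne_empty, hsum⟩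
  exact (Multiset.map_le_map (Finset.val_le_iff.2 (Finset.subset_univ t))).trans hl.le

/-- Pairing a sequence with length-counting coordinates and padding it gives control over the
length of a zero-sum subsequence modulo `p ^ m`. -/
theorem exists_zero_sum_card_mod {p : ℕ} [Fact p.Prime] {G ι : Type*} [AddCommGroup G]
    [Fintype ι] (e : ι → G) (k : ι → ℕ) (he : ∀ j, p ^ k j • e j = 0)
    (hgen : AddSubgroup.closure (Set.range e) = ⊤) (m i : ℕ) (hi : 1 ≤ i) (him : i ≤ p ^ m)
    (S : Multiset G) (hS : ∑ j, (p ^ k j - 1) + i ≤ Multiset.card S) :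
    ∃ T ≤ S, T ≠ 0 ∧ T.sum = 0 ∧
      ∃ r, i ≤ r ∧ r ≤ p ^ m ∧ Multiset.card T % p ^ m = r % p ^ m := by
  classical
  let e' : Option ι → G × ZMod (p ^ m) := fun o ↦ o.elim (0, 1) fun j ↦ (e j, 0)
  let k' : Option ι → ℕ := fun o ↦ o.elim m k
  have he' : ∀ o, p ^ k' o • e' o = 0 := by
    rintro (_ | j)
    · have : ((p : ZMod (p ^ m)) ^ m) = 0 := by
        rw [← Nat.cast_pow, ZMod.natCast_self]
      simp [e', k', this, -CharP.cast_eq_zero]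
    · simp [e', k', he]
  have hgen' : AddSubgroup.closure (Set.range e') = ⊤ := by
    have h1 (g : G) : ((g, 0) : G × ZMod (p ^ m)) ∈ AddSubgroup.closure (Set.range e') := by
      have hle : AddSubgroup.closure (Set.range e) ≤
          (AddSubgroup.closure (Set.range e')).comap (AddMonoidHom.inl G (ZMod (p ^ m))) := by
        rw [AddSubgroup.closure_le]
        rintro _ ⟨j, rfl⟩
        exact AddSubgroup.subset_closure ⟨some j, rfl⟩
      exact hle (hgen ▸ AddSubgroup.mem_top g)
    rw [eq_top_iff]
    rintro ⟨g, z⟩ -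
    obtain ⟨z, rfl⟩ := ZMod.intCast_surjective z
    have : ((g, (z : ZMod (p ^ m))) : G × ZMod (p ^ m)) = (g, 0) + z • e' none := by
      simp [e']
    rw [this]
    exact AddSubgroup.add_mem _ (h1 g)
      (AddSubgroup.zsmul_mem _ (AddSubgroup.subset_closure (Set.mem_range_self none)) z)
  obtain ⟨T, hT, hT0, hTsum⟩ := exists_zero_sum_submultiset e' k' he' hgen'
    (S.map (fun g ↦ (g, 1)) + Multiset.replicate (p ^ m - i) (0, 1)) (by
      simp only [Fintype.sum_option, k', Option.elim, Multiset.card_add, Multiset.card_map,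
        Multiset.card_replicate]
      omega)
  obtain ⟨T₁, hT₁, T₂, hT₂, rfl⟩ := exists_add_eq_of_le_add hT
  obtain ⟨U, hU, rfl⟩ := exists_map_eq_of_le_map hT₁
  obtain ⟨c, hc, rfl⟩ := Multiset.le_replicate_iff.1 hT₂
  have hpair (V : Multiset G) : (V.map fun g ↦ ((g, 1) : G × ZMod (p ^ m))).sum =
      (V.sum, (Multiset.card V : ZMod (p ^ m))) := by
    induction V using Multiset.induction_on with
    | empty => simp [Prod.zero_eq_mk]
    | cons a V ih => simp [ih, add_comm]
  rw [Multiset.sum_add, hpair, Multiset.sum_replicate, Prod.smul_mk, smul_zero, nsmul_one,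
    Prod.mk_add_mk, add_zero, Prod.mk_eq_zero] at hTsum
  obtain ⟨hfst, hsnd⟩ := hTsum
  rw [← Nat.cast_add, ZMod.natCast_eq_zero_iff] at hsnd
  refine ⟨U, hU, ?_, hfst, p ^ m - c, by omega, by omega, ?_⟩
  · rintro rfl
    rw [Multiset.card_zero, zero_add] at hsnd
    have hc0 : c = 0 := Nat.eq_zero_of_dvd_of_lt hsnd (by omega)
    simp [hc0] at hT0
  · refine Nat.ModEq.add_right_cancel' c ?_
    rw [Nat.sub_add_cancel (by omega)]
    exact ((Nat.modEq_zero_iff_dvd).2 hsnd).trans ((Nat.modEq_zero_iff_dvd).2 dvd_rfl).symm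

/-- For a finite abelian `p`-group `G` with `n = exp(G)` and `1 ≤ i ≤ n`,
we have `ζ_i(G) = D(G) + i − 1`. -/
theorem stmt2 (p : ℕ) (hp : p.Prime) (G : Type*) [AddCommGroup G] [Finite G]
    (hpG : ∀ g : G, ∃ k : ℕ, p ^ k • g = 0)
    (i : ℕ) (hi1 : 1 ≤ i) (hin : i ≤ AddMonoid.exponent G) :
    zetaI G i = davenport G + i - 1 := by
  have : Fact p.Prime := ⟨hp⟩
  obtain ⟨ι, _, e, k, he, hgen, hind⟩ := exists_independent_generators hp G hpG
  obtain ⟨m, hm⟩ : ∃ m, AddMonoid.exponent G = p ^ m := by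
    have : IsPGroup p (Multiplicative G) := hpG
    rw [← Monoid.exponent_multiplicative]
    exact this.exists_exponent_eq_pow
  obtain ⟨S, hScard, hSfree⟩ := exists_zero_sum_free_of_independent e (fun j ↦ p ^ k j)
    (fun j ↦ pow_pos hp.pos _) hind
  have hD : davenport G = ∑ j, (p ^ k j - 1) + 1 := by
    refine zsInv_eq_succ (fun S' hS' ↦ ?_) hScard fun T hT hT0 hsum ↦
      absurd (hSfree T hT hsum) hT0
    obtain ⟨T, hT, hT0, hsum⟩ := exists_zero_sum_submultiset e k he hgen S' hS'
    exact ⟨T, hT, hT0, hsum, Multiset.card_pos.2 hT0⟩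
  have hZ : zetaI G i = ∑ j, (p ^ k j - 1) + (i - 1) + 1 := by
    refine zsInv_eq_succ (S := S + Multiset.replicate (i - 1) 0) (fun S' hS' ↦ ?_)
      (by simp [hScard]) ?_
    · obtain ⟨T, hT, hT0, hsum, hr⟩ := exists_zero_sum_card_mod e k he hgen m i hi1
        (hm ▸ hin) S' (by omega)
      exact ⟨T, hT, hT0, hsum, Multiset.card_pos.2 hT0, by rwa [hm]⟩
    · rintro T hT hT0 hsum ⟨hpos, r, hir, hrn, hmod⟩
      obtain ⟨T₁, hT₁, T₂, hT₂, rfl⟩ : ∃ T₁ ≤ S, ∃ T₂ ≤ Multiset.replicate (i - 1) 0,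
        T₁ + T₂ = T := exists_add_eq_of_le_add hT
      obtain ⟨c, hc, rfl⟩ := Multiset.le_replicate_iff.1 hT₂
      obtain rfl : T₁ = 0 := hSfree _ hT₁ (by simpa using hsum)
      simp only [zero_add, Multiset.card_replicate] at hpos hmod
      rw [Nat.mod_eq_of_lt (by omega)] at hmod
      rcases hrn.eq_or_lt with rfl | hlt
      · rw [Nat.mod_self] at hmod; omega
      · rw [Nat.mod_eq_of_lt hlt] at hmod; omega
  omega
end

section
/- Let p be a prime and let G be a finite abelian p-group with Davenport constant D(G) ≤ 2·exp(G) − 1. Then every zero-sum sequence over G of length at least D(G) + 1 contains a nonempty zero-sum subsequence of length at most exp(G). -/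
namespace ZeroSum

open Finset

/-- A finite abelian `p`-group has a basis of elements of `p`-power order. -/
lemma exists_primePow_basis {p : ℕ} (hp : p.Prime) (G : Type*) [AddCommGroup G] [Finite G]
    (hpG : ∀ g : G, ∃ k : ℕ, p ^ k • g = 0) :
    ∃ (ι : Type) (_ : Fintype ι) (b : ι → G) (f : ι → ℕ),
      (∀ g, ∃ c : ι → ℕ, g = ∑ i, c i • b i) ∧ (∀ i, p ^ f i • b i = 0) ∧
      ∀ c : ι → ℕ, ∑ i, c i • b i = 0 → ∀ i, p ^ f i ∣ c i := by
  classical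
  obtain ⟨ι, _, n, hn, ⟨e⟩⟩ := AddCommGroup.equiv_directSum_zmod_of_finite' G
  have hn0 (i : ι) : NeZero (n i) := ⟨by have := hn i; omega⟩
  let b (i : ι) : G := e.symm (DirectSum.of (fun i => ZMod (n i)) i 1)
  have hsum (c : ι → ℕ) (i : ι) : e (∑ j, c j • b j) i = (c i : ZMod (n i)) := by
    rw [map_sum, DFinsupp.finsetSum_apply, sum_eq_single i]
    · rw [map_nsmul, DFinsupp.smul_apply, AddEquiv.apply_symm_apply, DirectSum.of_eq_same,
        nsmul_one]
    · intro j _ hj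
      rw [map_nsmul, DFinsupp.smul_apply, AddEquiv.apply_symm_apply,
        DirectSum.of_eq_of_ne _ _ _ hj.symm, smul_zero]
    · simp
  have hsmul (k : ℕ) (i : ι) : k • b i = 0 ↔ n i ∣ k := by
    rw [← ZMod.natCast_eq_zero_iff, ← e.map_eq_zero_iff]
    simp only [b, map_nsmul, AddEquiv.apply_symm_apply]
    rw [← map_nsmul, nsmul_one]
    exact map_eq_zero_iff _ (DirectSum.of_injective i)
  have hf (i : ι) : ∃ f, n i = p ^ f := by
    obtain ⟨k, hk⟩ := hpG (b i)
    obtain ⟨f, -, hf⟩ := (Nat.dvd_prime_pow hp).1 ((hsmul _ _).1 hk)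
    exact ⟨f, hf⟩
  choose f hf using hf
  refine ⟨ι, inferInstance, b, f, fun g => ⟨fun i => (e g i).val, ?_⟩,
    fun i => (hsmul _ _).2 (hf i).dvd, fun c hc i => ?_⟩
  · apply e.injective
    ext i
    rw [hsum, ZMod.natCast_zmod_val]
  · rw [← hf, ← ZMod.natCast_eq_zero_iff, ← hsum, hc]
    simp

lemma ideal_sup_pow_eq_bot {R : Type*} [CommRing R] {I J : Ideal R} {a b : ℕ}
    (hI : I ^ (a + 1) = ⊥) (hJ : J ^ (b + 1) = ⊥) : (I ⊔ J) ^ (a + b + 1) = ⊥ := by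
  rw [← Ideal.add_eq_sup, add_pow, Ideal.sum_eq_sup, eq_bot_iff]
  refine Finset.sup_le fun i _ => ?_
  by_cases h : a + 1 ≤ i
  · exact Ideal.mul_le_left.trans
      (Ideal.mul_le_left.trans ((Ideal.pow_le_pow_right h).trans hI.le))
  · exact Ideal.mul_le_left.trans (Ideal.mul_le_right.trans
      ((Ideal.pow_le_pow_right (by omega)).trans hJ.le))

lemma ideal_finset_sup_pow_eq_bot {R ι : Type*} [CommRing R] (I : ι → Ideal R) (a : ι → ℕ)
    (h : ∀ i, I i ^ (a i + 1) = ⊥) (s : Finset ι) : s.sup I ^ (∑ i ∈ s, a i + 1) = ⊥ := by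
  classical
  induction s using Finset.induction_on with
  | empty => simp
  | insert i s hi ih =>
    rw [sup_insert, sum_insert hi]
    exact ideal_sup_pow_eq_bot (h i) ih

lemma one_sub_single_mem {R G : Type*} [CommRing R] [AddCommGroup G]
    (I : Ideal (AddMonoidAlgebra R G)) {ι : Type*} (s : Finset ι) (b : ι → G) (c : ι → ℕ)
    (h : ∀ i ∈ s, 1 - AddMonoidAlgebra.single (b i) 1 ∈ I) :
    1 - AddMonoidAlgebra.single (∑ i ∈ s, c i • b i) 1 ∈ I := by
  let N : AddSubmonoid G :=
    { carrier := {g | 1 - AddMonoidAlgebra.single g 1 ∈ I}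
      zero_mem' := by simp [← AddMonoidAlgebra.one_def]
      add_mem' := by
        intro x y hx hy
        have key : (1 - AddMonoidAlgebra.single (x + y) 1 : AddMonoidAlgebra R G) =
            (1 - AddMonoidAlgebra.single x 1) +
              AddMonoidAlgebra.single x 1 * (1 - AddMonoidAlgebra.single y 1) := by
          rw [mul_sub, AddMonoidAlgebra.single_mul_single]
          simp
        change _ ∈ I
        rw [key]
        exact I.add_mem hx (I.mul_mem_left _ hy) }
  exact N.sum_mem fun i hi => N.nsmul_mem (h i hi) _

/-- Olson's bounds: the length of a zero-sum free sequence determines an exponent that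
annihilates the augmentation ideal of the modular group algebra. -/
lemma exists_zeroSumFree_and_prod_eq_zero {p : ℕ} (hp : p.Prime) (G : Type*) [AddCommGroup G]
    [Finite G] (hpG : ∀ g : G, ∃ k : ℕ, p ^ k • g = 0) :
    ∃ S : Multiset G, (∀ T ≤ S, T.sum = 0 → T = 0) ∧
      ∀ {κ : Type} (x : κ → G) (R : Finset κ), S.card + 1 ≤ #R →
        ∏ i ∈ R, (1 - AddMonoidAlgebra.single (x i) 1 : AddMonoidAlgebra (ZMod p) G) = 0 := by
  classical
  obtain ⟨ι, _, b, f, hgen, hord, hind⟩ := exists_primePow_basis hp G hpG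
  have : Fact p.Prime := ⟨hp⟩
  have hpos (i : ι) : 0 < p ^ f i := pow_pos hp.pos _
  let S₀ : Multiset ι := ∑ i, Multiset.replicate (p ^ f i - 1) i
  have hcount (i : ι) : S₀.count i = p ^ f i - 1 := by
    simp [S₀, Multiset.count_sum', Multiset.count_replicate]
  refine ⟨S₀.map b, fun T hT hsum => ?_, fun x R hR => ?_⟩
  · obtain ⟨T₀, hT₀, rfl⟩ : ∃ T₀ ≤ S₀, T₀.map b = T := by
      obtain ⟨l, hl⟩ := Quot.exists_rep S₀
      obtain ⟨t, ht⟩ := Quot.exists_rep T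
      subst ht
      rw [← hl] at hT ⊢
      obtain ⟨u, hu, hsub⟩ : List.Subperm t (l.map b) := hT
      obtain ⟨v, hv, rfl⟩ := List.sublist_map_iff.1 hsub
      exact ⟨(v : Multiset ι), Multiset.coe_le.2 hv.subperm, Multiset.coe_eq_coe.2 hu⟩
    rw [Finset.sum_multiset_map_count, sum_subset (subset_univ _)] at hsum
    · have h0 : T₀ = 0 := by
        refine Multiset.ext.2 fun i => ?_
        have hle := Multiset.le_iff_count.1 hT₀ i
        rw [hcount] at hle
        have := hpos i
        rw [Multiset.count_zero]
        exact Nat.eq_zero_of_dvd_of_lt (hind _ hsum i) (by omega)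
      simp [h0]
    · intro i _ hi
      rw [Multiset.mem_toFinset] at hi
      simp [Multiset.count_eq_zero.2 hi]
  · let I (i : ι) : Ideal (AddMonoidAlgebra (ZMod p) G) :=
      Ideal.span {1 - AddMonoidAlgebra.single (b i) 1}
    have hI (i : ι) : I i ^ (p ^ f i - 1 + 1) = ⊥ := by
      have : CharP (AddMonoidAlgebra (ZMod p) G) p :=
        charP_of_injective_algebraMap (algebraMap (ZMod p) _).injective p
      rw [Nat.sub_add_cancel (hpos i), Ideal.span_singleton_pow, Ideal.span_singleton_eq_bot,
        sub_pow_char_pow, AddMonoidAlgebra.single_pow, hord]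
      simp [AddMonoidAlgebra.one_def]
    have hbot := ideal_finset_sup_pow_eq_bot I _ hI univ
    have hmem (g : G) : 1 - AddMonoidAlgebra.single g 1 ∈ univ.sup I := by
      obtain ⟨c, rfl⟩ := hgen g
      exact one_sub_single_mem _ _ _ _ fun i hi =>
        Finset.le_sup (f := I) hi (Ideal.subset_span rfl)
    have hcard : (S₀.map b).card = ∑ i, (p ^ f i - 1) := by simp [S₀]
    rw [hcard] at hR
    rw [← Ideal.mem_bot, ← hbot]
    refine Ideal.pow_le_pow_right hR ?_
    rw [← prod_const]
    exact Ideal.prod_mem_prod fun i _ => hmem _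

/-- If `∏ (1 - X ^ (x i))` vanishes in the group algebra, then the zero-sum subsequences of `x`
of even and of odd length are equally many in `R`. -/
lemma sum_neg_one_pow_eq_zero {R G κ : Type*} [CommRing R] [AddCommGroup G] [DecidableEq G]
    (x : κ → G) (s : Finset κ)
    (h : ∏ i ∈ s, (1 - AddMonoidAlgebra.single (x i) 1 : AddMonoidAlgebra R G) = 0) :
    ∑ t ∈ s.powerset with ∑ i ∈ t, x i = 0, (-1 : R) ^ #t = 0 := by
  classical
  have hsingle (t : Finset κ) : ∏ i ∈ t, (-AddMonoidAlgebra.single (x i) (1 : R)) =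
      AddMonoidAlgebra.single (∑ i ∈ t, x i) ((-1) ^ #t) := by
    induction t using Finset.induction_on with
    | empty => simp [AddMonoidAlgebra.one_def]
    | insert a t ha ih =>
      rw [prod_insert ha, ih, sum_insert ha, card_insert_of_notMem ha, ← AddMonoidAlgebra.single_neg,
        AddMonoidAlgebra.single_mul_single, pow_succ']
  simp_rw [sub_eq_add_neg] at h
  rw [prod_one_add] at h
  simp_rw [hsingle] at h
  have h0 := congrArg (fun y : AddMonoidAlgebra R G => y.coeff 0) h
  rw [sum_filter]
  simpa [Finsupp.single_apply] using h0

section Davenport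

variable {G : Type*} [AddCommGroup G]

lemma exists_zeroSum_of_davenport_le
    (h : ∃ ℓ : ℕ, 0 < ℓ ∧ ∀ S : Multiset G, ℓ ≤ S.card →
      ∃ T : Multiset G, T ≤ S ∧ T ≠ 0 ∧ T.sum = 0 ∧ T.card ∈ {t | 0 < t})
    (S : Multiset G) (hS : davenport G ≤ S.card) : ∃ T ≤ S, T ≠ 0 ∧ T.sum = 0 := by
  obtain ⟨T, h₁, h₂, h₃, -⟩ := (Nat.sInf_mem h).2 S hS
  exact ⟨T, h₁, h₂, h₃⟩

/-- For a finite abelian `p`-group, `D(G)` elements `1 - X ^ g` of the modular group algebra have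
product zero, and every sequence of length `D(G)` has a nonempty zero-sum subsequence. -/
lemma davenport_spec {p : ℕ} (hp : p.Prime) [Finite G]
    (hpG : ∀ g : G, ∃ k : ℕ, p ^ k • g = 0) :
    (∀ S : Multiset G, davenport G ≤ S.card → ∃ T ≤ S, T ≠ 0 ∧ T.sum = 0) ∧
      ∀ {κ : Type} (x : κ → G) (R : Finset κ), davenport G ≤ #R →
        ∏ i ∈ R, (1 - AddMonoidAlgebra.single (x i) 1 : AddMonoidAlgebra (ZMod p) G) = 0 := by
  classical
  have : Fact p.Prime := ⟨hp⟩
  obtain ⟨F, hF, hprod⟩ := exists_zeroSumFree_and_prod_eq_zero hp G hpG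
  have hzs := exists_zeroSum_of_davenport_le (G := G) ⟨F.card + 1, by omega, fun S hS => by
    induction S using Quotient.inductionOn with | _ l
    have hsum := sum_neg_one_pow_eq_zero (R := ZMod p) l.get univ (hprod _ _ (by simpa using hS))
    obtain ⟨t, ht, hne⟩ : ∃ t ∈ univ.powerset.filter fun t => ∑ i ∈ t, l.get i = 0, t ≠ ∅ := by
      by_contra! hall
      rw [sum_eq_single_of_mem ∅ (by simp) fun t ht hne => absurd (hall t ht) hne] at hsum
      simp at hsum
    refine ⟨t.val.map l.get, ?_, ?_, (mem_filter.1 ht).2, ?_⟩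
    · calc t.val.map l.get ≤ (univ : Finset (Fin l.length)).val.map l.get :=
            Multiset.map_le_map (val_le_iff.2 (subset_univ _))
        _ = _ := by simp [Fin.univ_val_map]
    · simpa using hne
    · simpa [card_pos, nonempty_iff_ne_empty] using hne⟩
  refine ⟨hzs, fun x R hR => hprod x R (le_trans ?_ hR)⟩
  by_contra! hlt
  obtain ⟨T, hT, hne, hsum⟩ := hzs F (by omega)
  exact hne (hF T hT hsum)

/-- A zero-sum sequence of length between `D(G) + 1` and `2 n` has a nonempty zero-sum subsequence
of length at most `n`. -/
lemma exists_short_of_card_le_two_mul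
    (hzs : ∀ S : Multiset G, davenport G ≤ S.card → ∃ T ≤ S, T ≠ 0 ∧ T.sum = 0) {n : ℕ}
    (S : Multiset G) (hS : S.sum = 0) (hD : davenport G + 1 ≤ S.card) (hn : S.card ≤ 2 * n) :
    ∃ T ≤ S, T ≠ 0 ∧ T.sum = 0 ∧ T.card ≤ n := by
  obtain ⟨a, ha⟩ := Multiset.card_pos_iff_exists_mem.1 (by omega : 0 < S.card)
  obtain ⟨S', rfl⟩ := Multiset.exists_cons_of_mem ha
  rw [Multiset.card_cons] at hD hn
  obtain ⟨T, hT, hne, hsum⟩ := hzs S' (by omega)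
  obtain ⟨U, rfl⟩ := Multiset.le_iff_exists_add.1 hT
  rw [Multiset.card_add] at hn
  by_cases h : T.card ≤ n
  · exact ⟨T, hT.trans (Multiset.le_cons_self _ _), hne, hsum, h⟩
  · refine ⟨a ::ₘ U, Multiset.cons_le_cons _ (Multiset.le_add_left _ _), Multiset.cons_ne_zero,
      ?_, by rw [Multiset.card_cons]; omega⟩
    simpa [hsum] using hS

end Davenport

lemma primePow_add_choose_modEq {p k : ℕ} (hp : p.Prime) (a e : ℕ) (he : e < p ^ k) :
    (p ^ k + a).choose e ≡ a.choose e [MOD p] := by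
  rw [Nat.add_choose_eq, ← ZMod.natCast_eq_natCast_iff, Nat.cast_sum,
    sum_eq_single_of_mem (0, e) (by simp)]
  · simp
  · rintro ⟨i, j⟩ hij hne
    rw [Finset.HasAntidiagonal.mem_antidiagonal] at hij
    have hi : i ≠ 0 := by
      rintro rfl
      exact hne (by simpa using hij)
    rw [ZMod.natCast_eq_zero_iff]
    exact (hp.dvd_choose_pow hi (by simp only at hij; omega)).mul_right _

/-- A sequence of length `2 n + e`, with `e < n` and `n` a power of `p`, has a nonempty zero-sum
subsequence whose length avoids `[n + 1, n + e]` and, if `e ≠ 0`, `2 n + e`. -/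
lemma exists_zeroSum_card_of_prod_eq_zero {p k e : ℕ} (hp : p.Prime) {G : Type*} [AddCommGroup G]
    (he : e < p ^ k) (l : List G) (hl : l.length = 2 * p ^ k + e)
    (hprod : ∀ R : Finset (Fin l.length), 2 * p ^ k ≤ #R →
      ∏ i ∈ R, (1 - AddMonoidAlgebra.single (l.get i) 1 : AddMonoidAlgebra (ZMod p) G) = 0) :
    ∃ T : Multiset G, T ≤ l ∧ T ≠ 0 ∧ T.sum = 0 ∧
      ¬ (p ^ k < T.card ∧ T.card ≤ p ^ k + e) ∧ ¬ (e ≠ 0 ∧ T.card = 2 * p ^ k + e) := by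
  classical
  have : Fact p.Prime := ⟨hp⟩
  set n := p ^ k with hn
  by_contra! hcon
  have hdouble : ∑ E ∈ powersetCard e (univ : Finset (Fin l.length)),
      ∑ t ∈ Eᶜ.powerset with ∑ i ∈ t, l.get i = 0, (-1 : ZMod p) ^ #t = 0 := by
    refine sum_eq_zero fun E hE => sum_neg_one_pow_eq_zero _ _ (hprod _ ?_)
    rw [card_compl, Fintype.card_fin, (mem_powersetCard.1 hE).2]
    omega
  rw [sum_comm' (t' := univ.filter fun t => ∑ i ∈ t, l.get i = 0)
    (s' := fun t => powersetCard e tᶜ)] at hdouble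
  swap
  · intro E t
    simp only [mem_powersetCard, mem_filter, mem_powerset, subset_univ, mem_univ, true_and]
    rw [subset_compl_comm]
    tauto
  simp_rw [sum_const, card_powersetCard, card_compl, Fintype.card_fin] at hdouble
  rw [sum_eq_single_of_mem ∅ (by simp)] at hdouble
  · have h₁ := (primePow_add_choose_modEq (k := k) hp (n + e) e he).trans
      (primePow_add_choose_modEq hp e e he)
    rw [← hn, ← add_assoc, ← two_mul, ← hl, ← ZMod.natCast_eq_natCast_iff] at h₁
    simp [h₁] at hdouble
  · intro t ht hne
    have hle : t.val.map l.get ≤ (l : Multiset G) :=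
      calc t.val.map l.get ≤ (univ : Finset (Fin l.length)).val.map l.get :=
            Multiset.map_le_map (val_le_iff.2 (subset_univ _))
        _ = _ := by simp [Fin.univ_val_map]
    have htl := Multiset.card_le_card hle
    have hT := hcon (t.val.map l.get) hle (by simpa using hne) (mem_filter.1 ht).2
    simp only [Multiset.card_map, card_val, Multiset.coe_card] at hT htl
    have hzero : ((l.length - #t).choose e : ZMod p) = 0 := by
      by_cases hmid : n < #t ∧ #t ≤ n + e
      · obtain ⟨j, hj⟩ : ∃ j, l.length - #t = n + j := ⟨n + e - #t, by omega⟩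
        have := (ZMod.natCast_eq_natCast_iff _ _ _).2 (primePow_add_choose_modEq (k := k) hp j e he)
        rw [hj, this, Nat.choose_eq_zero_of_lt (by omega), Nat.cast_zero]
      · have hT' := hT fun h => by omega
        rw [Nat.choose_eq_zero_of_lt (by omega), Nat.cast_zero]
    rw [nsmul_eq_mul, hzero, zero_mul]

end ZeroSum

/-- For a finite abelian `p`-group `G` with `D(G) ≤ 2·exp(G) − 1`, every
zero-sum sequence over `G` of length at least `D(G) + 1` contains a nonempty zero-sum
subsequence of length at most `exp(G)`. -/
theorem stmt3 (p : ℕ) (hp : p.Prime) (G : Type*) [AddCommGroup G] [Finite G]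
    (hpG : ∀ g : G, ∃ k : ℕ, p ^ k • g = 0)
    (hD : davenport G ≤ 2 * AddMonoid.exponent G - 1)
    (S : Multiset G) (hSsum : S.sum = 0) (hScard : davenport G + 1 ≤ Multiset.card S) :
    ∃ T : Multiset G, T ≤ S ∧ T ≠ 0 ∧ T.sum = 0 ∧
      Multiset.card T ≤ AddMonoid.exponent G := by
  obtain ⟨hzs, hprod⟩ := ZeroSum.davenport_spec hp hpG
  obtain ⟨k, hk⟩ : ∃ k, AddMonoid.exponent G = p ^ k := by
    obtain ⟨g, hg⟩ := AddMonoid.exists_addOrderOf_eq_exponent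
      (AddMonoid.ExponentExists.of_finite (G := G))
    obtain ⟨j, hj⟩ := hpG g
    obtain ⟨k, -, hk⟩ := (Nat.dvd_prime_pow hp).1 (addOrderOf_dvd_of_nsmul_eq_zero hj)
    exact ⟨k, hg ▸ hk⟩
  rw [hk] at hD ⊢
  have hn : 0 < p ^ k := pow_pos hp.pos k
  have hmid (S : Multiset G) (hS : S.sum = 0) (hcard : davenport G + 1 ≤ S.card)
      (hlt : S.card < 3 * p ^ k) : ∃ T ≤ S, T ≠ 0 ∧ T.sum = 0 ∧ T.card ≤ p ^ k := by
    by_cases hle : S.card ≤ 2 * p ^ k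
    · exact ZeroSum.exists_short_of_card_le_two_mul hzs S hS hcard hle
    obtain ⟨e, he⟩ := Nat.exists_eq_add_of_le (not_le.1 hle).le
    induction S using Quotient.inductionOn with | _ l
    obtain ⟨T, hT, hne, hsum, h₁, h₂⟩ := ZeroSum.exists_zeroSum_card_of_prod_eq_zero hp
      (k := k) (e := e) (by omega) l (by simpa using he) fun R hR => hprod _ R (by omega)
    by_cases hTn : T.card ≤ p ^ k
    · exact ⟨T, hT, hne, hsum, hTn⟩
    obtain ⟨U, hU⟩ := Multiset.le_iff_exists_add.1 hT
    change _ = T + U at hU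
    have hU' : Multiset.card (T + U) = 2 * p ^ k + e := hU ▸ he
    have hUsum : (T + U).sum = 0 := hU ▸ hS
    rw [Multiset.card_add] at hU'
    refine ⟨U, ?_, ?_, by simpa [hsum] using hUsum, by omega⟩
    · change U ≤ (l : Multiset G)
      exact hU ▸ Multiset.le_add_left _ _
    · rintro rfl
      rw [Multiset.card_zero] at hU'
      omega
  by_cases hlt : S.card < 3 * p ^ k
  · exact hmid S hSsum hScard hlt
  obtain ⟨S', hS', hcard'⟩ : ∃ S' ≤ S, S'.card = 3 * p ^ k - 1 := by
    induction S using Quotient.inductionOn with | _ l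
    refine ⟨(l.take (3 * p ^ k - 1) : List G), (List.take_sublist _ _).subperm, ?_⟩
    rw [Multiset.quot_mk_to_coe, Multiset.coe_card] at hlt
    rw [Multiset.coe_card, List.length_take]
    omega
  induction S' using Quotient.inductionOn with | _ l
  obtain ⟨T, hT, hne, hsum, h₁, h₂⟩ := ZeroSum.exists_zeroSum_card_of_prod_eq_zero hp
    (k := k) (e := p ^ k - 1) (by omega) l (by simp at hcard'; omega)
    fun R hR => hprod _ R (by omega)
  have hTcard := (Multiset.card_le_card hT).trans_eq hcard'
  by_cases hTn : T.card ≤ p ^ k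
  · exact ⟨T, hT.trans hS', hne, hsum, hTn⟩
  obtain ⟨U, hU, hU'⟩ := hmid T hsum (by omega) (by omega)
  exact ⟨U, hU.trans (hT.trans hS'), hU'⟩
end

section
/- Let p be a prime and let G be a finite abelian p-group with Davenport constant D(G) ≤ 2·exp(G) − 1. For every integer i with 1 ≤ i ≤ 2·exp(G) − D(G), any zero-sum sequence S over G of length exactly D(G) + i contains a nonempty zero-sum subsequence of length at least i and at most exp(G). -/
open Finset

/-- Double counting: deleting `k`-subsets `R ⊆ V` weights each `T ⊆ U` by the number of
`k`-subsets of `V` disjoint from `T`. -/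
theorem sum_powerset_mul_choose_eq_zero {ι R : Type*} [DecidableEq ι] [CommRing R]
    (a : Finset ι → R) {U V : Finset ι} (k : ℕ)
    (h : ∀ K ∈ V.powersetCard k, ∑ T ∈ (U \ K).powerset, a T = 0) :
    ∑ T ∈ U.powerset, a T * ((V \ T).card.choose k : R) = 0 := by
  have key : ∀ T, a T * ((V \ T).card.choose k : R) =
      ∑ K ∈ V.powersetCard k, if Disjoint T K then a T else 0 := by
    intro T
    rw [← sum_filter, sum_const, nsmul_eq_mul, mul_comm, ← card_powersetCard]
    congr 3
    ext K
    simp only [mem_powersetCard, mem_filter, subset_sdiff, disjoint_comm]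
    tauto
  rw [sum_congr rfl fun T _ => key T, sum_comm]
  refine sum_eq_zero fun K hK => ?_
  rw [← sum_filter, ← h K hK]
  congr 1
  ext T
  simp [subset_sdiff]

theorem choose_prime_pow_add_eq_choose {p : ℕ} (hp : p.Prime) (m b : ℕ) {k : ℕ} (hk : k < p ^ m) :
    ((p ^ m + b).choose k : ZMod p) = (b.choose k : ZMod p) := by
  rw [Nat.add_choose_eq, Nat.cast_sum, sum_eq_single (0, k)]
  · simp
  · rintro ⟨x, y⟩ hxy hne
    rw [HasAntidiagonal.mem_antidiagonal] at hxy
    have hx : x ≠ 0 := by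
      rintro rfl
      simp at hxy
      exact hne (by simp [hxy])
    rw [Nat.cast_mul, (ZMod.natCast_eq_zero_iff _ _).2 (hp.dvd_choose_pow hx (by omega)), zero_mul]
  · simp

/-- `∑ (-1)^|T|` over the index sets `T ⊆ U` of zero-sum subfamilies of `g`. -/
def altZeroSumCount {ι G : Type*} [AddCommGroup G] [DecidableEq G] (R : Type*) [CommRing R]
    (g : ι → G) (U : Finset ι) : R :=
  ∑ T ∈ U.powerset, if ∑ j ∈ T, g j = 0 then (-1) ^ T.card else 0

theorem altZeroSumCount_eq_coeff {ι G R : Type*} [AddCommGroup G] [DecidableEq G] [CommRing R]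
    (g : ι → G) (U : Finset ι) :
    altZeroSumCount R g U = (∏ j ∈ U, (1 - AddMonoidAlgebra.single (g j) (1 : R))).coeff 0 := by
  classical
  have hprod : ∀ T : Finset ι, ∏ j ∈ T, -AddMonoidAlgebra.single (g j) (1 : R) =
      AddMonoidAlgebra.single (∑ j ∈ T, g j) ((-1) ^ T.card) := by
    intro T
    induction T using Finset.induction_on with
    | empty => simp [AddMonoidAlgebra.one_def]
    | insert a s ha ih =>
      rw [prod_insert ha, ih, sum_insert ha, card_insert_of_notMem ha, ← AddMonoidAlgebra.single_neg,
        AddMonoidAlgebra.single_mul_single, pow_succ']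
  simp_rw [sub_eq_neg_add, prod_add, prod_const_one, mul_one, hprod, AddMonoidAlgebra.coeff_sum,
    Finsupp.finsetSum_apply, AddMonoidAlgebra.coeff_single, Finsupp.single_apply, altZeroSumCount]

theorem one_sub_single_mem_of_closure_eq_top {ι G R : Type*} [AddCommGroup G] [CommRing R]
    {e : ι → G} (he : AddSubgroup.closure (Set.range e) = ⊤) {I : Ideal (AddMonoidAlgebra R G)}
    (hI : ∀ j, 1 - AddMonoidAlgebra.single (e j) 1 ∈ I) (h : G) :
    1 - AddMonoidAlgebra.single h 1 ∈ I := by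
  have hh : h ∈ AddSubgroup.closure (Set.range e) := he ▸ AddSubgroup.mem_top h
  induction hh using AddSubgroup.closure_induction with
  | mem x hx => obtain ⟨j, rfl⟩ := hx; exact hI j
  | zero => simp [← AddMonoidAlgebra.one_def]
  | add x y _ _ hx hy =>
    convert! I.add_mem hx (I.mul_mem_left (AddMonoidAlgebra.single x 1) hy) using 1
    rw [mul_sub, AddMonoidAlgebra.single_mul_single]
    simp
  | neg x _ hx =>
    convert! I.mul_mem_left (-AddMonoidAlgebra.single (-x) 1) hx using 1
    rw [mul_sub, neg_mul, neg_mul, AddMonoidAlgebra.single_mul_single]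
    simp [← AddMonoidAlgebra.one_def]
    abel

theorem sum_pow_eq_zero_of_pow_eq_zero {ι A : Type*} [CommSemiring A] {x : ι → A} {n : ι → ℕ}
    (hn : ∀ j, 1 ≤ n j) (hx : ∀ j, x j ^ n j = 0) (s : Finset ι) :
    (∑ j ∈ s, x j) ^ (∑ j ∈ s, (n j - 1) + 1) = 0 := by
  classical
  induction s using Finset.induction_on with
  | empty => simp
  | insert a s ha ih =>
    rw [sum_insert ha, sum_insert ha]
    refine (Commute.all _ _).add_pow_eq_zero_of_add_le_succ_of_pow_eq_zero (hx a) ih ?_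
    have := hn a
    omega

/-- Olson: in `𝔽_p[G]` any product of `1 + ∑ (n j - 1)` elements of the augmentation ideal vanishes,
hence so does the alternating count of zero-sum subfamilies. -/
theorem altZeroSumCount_eq_zero {ι κ G : Type*} [AddCommGroup G] [DecidableEq G] [Fintype κ]
    {p : ℕ} (hp : p.Prime) {e : κ → G} {n : κ → ℕ}
    (he : AddSubgroup.closure (Set.range e) = ⊤) (hn : ∀ j, ∃ k, n j = p ^ k)
    (hne : ∀ j, n j • e j = 0) (g : ι → G) {U : Finset ι}
    (hU : ∑ j, (n j - 1) + 1 ≤ U.card) : altZeroSumCount (ZMod p) g U = 0 := by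
  have : Fact p.Prime := ⟨hp⟩
  rw [altZeroSumCount_eq_coeff]
  set I : Ideal (AddMonoidAlgebra (ZMod p) G) :=
    ∑ j, Ideal.span {1 - AddMonoidAlgebra.single (e j) 1} with hIdef
  have hI : I ^ (∑ j, (n j - 1) + 1) = 0 := by
    refine sum_pow_eq_zero_of_pow_eq_zero (fun j => ?_) (fun j => ?_) _
    · obtain ⟨k, hk⟩ := hn j
      rw [hk]
      exact Nat.one_le_pow _ _ hp.pos
    · obtain ⟨k, hk⟩ := hn j
      have : CharP (AddMonoidAlgebra (ZMod p) G) p :=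
        charP_of_injective_algebraMap (algebraMap (ZMod p) _).injective p
      rw [Ideal.span_singleton_pow, hk, sub_pow_char_pow, AddMonoidAlgebra.single_pow, ← hk, hne]
      simp [← AddMonoidAlgebra.one_def]
  have hmem : ∀ j, 1 - AddMonoidAlgebra.single (g j) 1 ∈ I := fun j =>
    one_sub_single_mem_of_closure_eq_top he (fun k => by
      rw [hIdef, Ideal.sum_eq_sup]
      exact le_sup (f := fun j => Ideal.span {1 - AddMonoidAlgebra.single (e j) (1 : ZMod p)})
        (mem_univ k) (Ideal.mem_span_singleton_self _)) _
  have hprod : ∏ j ∈ U, (1 - AddMonoidAlgebra.single (g j) (1 : ZMod p)) ∈ I ^ U.card := by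
    rw [← prod_const]
    exact Ideal.prod_mem_prod fun j _ => hmem j
  have := Ideal.pow_le_pow_right hU hprod
  rw [hI] at this
  rw [show ∏ j ∈ U, (1 - AddMonoidAlgebra.single (g j) (1 : ZMod p)) = 0 from this]
  simp

/-- A zero-sum family in which no index set of size in `[i, n]` is zero-sum contains a zero-sum
free index set of size `D - n`. -/
theorem exists_zeroSumFree {ι G : Type*} [Fintype ι] [DecidableEq ι] [AddCommGroup G]
    {g : ι → G} {D n i : ℕ} (hDi : D + i ≤ 2 * n) (hi : 1 ≤ i) (hnD : n ≤ D)
    (hcard : Fintype.card ι = D + i) (hsum : ∑ j, g j = 0)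
    (hgap : ∀ T : Finset ι, ∑ j ∈ T, g j = 0 → T.card ≤ i - 1 ∨ D + 1 ≤ T.card) :
    ∃ C : Finset ι, C.card = D - n ∧ ∀ T ⊆ C, ∑ j ∈ T, g j = 0 → T = ∅ := by
  obtain ⟨P, hP, hPmin⟩ := exists_minimal_of_wellFoundedLT
    (fun P : Finset ι => ∑ j ∈ P, g j = 0 ∧ D + 1 ≤ P.card)
    ⟨univ, hsum, by rw [card_univ, hcard]; omega⟩
  obtain ⟨W, ⟨hWP, hW0, hW⟩, hWmin⟩ := exists_minimal_of_wellFoundedLT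
    (fun W : Finset ι => W ⊆ P ∧ W.Nonempty ∧ ∑ j ∈ W, g j = 0)
    ⟨P, subset_rfl, card_pos.1 (by omega), hP.1⟩
  have hdiff : ∑ j ∈ P \ W, g j = 0 := by
    have := sum_sdiff (f := g) hWP
    rwa [hW, hP.1, add_zero] at this
  have hlt : (P \ W).card ≤ i - 1 := by
    refine (hgap _ hdiff).resolve_right fun hlarge => ?_
    have hsub := hPmin ⟨hdiff, hlarge⟩ sdiff_subset
    obtain ⟨w, hw⟩ := hW0
    exact (mem_sdiff.1 (hsub (hWP hw))).2 hw
  have hWcard := card_sdiff_add_card_eq_card hWP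
  obtain ⟨C, hCW, hC⟩ := exists_subset_card_eq (s := W) (n := D - n) (by omega)
  refine ⟨C, hC, fun T hT hT0 => ?_⟩
  by_contra hne
  have hsub := hWmin ⟨(hT.trans hCW).trans hWP, nonempty_iff_ne_empty.2 hne, hT0⟩ (hT.trans hCW)
  have := card_le_card (hsub.trans hT)
  omega

/-- If the alternating counts vanish modulo `p` from length `D` on, a zero-sum family
of length `D + i` has a zero-sum subfamily of length in `[i, p ^ m]`. -/
theorem exists_zeroSum_card_mem_Icc {ι G : Type*} [Fintype ι] [DecidableEq ι] [AddCommGroup G]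
    [DecidableEq G] {g : ι → G} {p m D i : ℕ} (hp : p.Prime)
    (hvanish : ∀ U : Finset ι, D ≤ U.card → altZeroSumCount (ZMod p) g U = 0)
    (hDi : D + i ≤ 2 * p ^ m) (hi : 1 ≤ i) (hnD : p ^ m ≤ D)
    (hcard : Fintype.card ι = D + i) (hsum : ∑ j, g j = 0) :
    ∃ T : Finset ι, ∑ j ∈ T, g j = 0 ∧ i ≤ T.card ∧ T.card ≤ p ^ m := by
  by_contra! hno
  have hgap : ∀ T : Finset ι, ∑ j ∈ T, g j = 0 → T.card ≤ i - 1 ∨ D + 1 ≤ T.card := by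
    intro T hT
    have h1 := hno T hT
    have h2 := hno Tᶜ (by rwa [← sum_add_sum_compl T g, hT, zero_add] at hsum)
    have h3 := card_add_card_compl T
    omega
  obtain ⟨C, hC, hCfree⟩ := exists_zeroSumFree hDi hi hnD hcard hsum hgap
  obtain ⟨x, hx⟩ : ∃ x, x ∉ C := by
    by_contra! h
    rw [eq_univ_of_forall h, card_univ] at hC
    omega
  set U : Finset ι := univ.erase x with hU
  have hCU : C ⊆ U := fun y hy => mem_erase.2 ⟨fun h => hx (h ▸ hy), mem_univ y⟩
  have hUcard : U.card = D + i - 1 := by rw [hU, card_erase_of_mem (mem_univ x), card_univ, hcard]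
  set V := U \ C with hV
  have hVcard : V.card = p ^ m + (i - 1) := by
    rw [hV, card_sdiff_of_subset hCU]
    omega
  have hzero := sum_powerset_mul_choose_eq_zero
    (fun T => if ∑ j ∈ T, g j = 0 then (-1 : ZMod p) ^ T.card else 0) (U := U) (V := V) (i - 1)
    (fun K hK => hvanish _ (by
      rw [mem_powersetCard] at hK
      have := card_sdiff_add_card_eq_card (hK.1.trans sdiff_subset : K ⊆ U)
      omega))
  have : Fact p.Prime := ⟨hp⟩
  rw [sum_eq_single ∅] at hzero
  · simp [hVcard, choose_prime_pow_add_eq_choose hp m (i - 1) (k := i - 1) (by omega)] at hzero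
  · intro T hTU hT
    rw [mem_powerset] at hTU
    split_ifs with hT0
    · have h1 : (V ∩ T).card ≤ T.card := card_le_card inter_subset_right
      have h2 : (V \ T).card + (V ∩ T).card = V.card := card_sdiff_add_card_inter V T
      have h3 : (V ∩ T).Nonempty := by
        rw [nonempty_iff_ne_empty]
        intro h
        refine hT (hCfree T (fun y hy => ?_) hT0)
        by_contra hyC
        exact notMem_empty y (h ▸ mem_inter.2 ⟨mem_sdiff.2 ⟨hTU hy, hyC⟩, hy⟩)
      have h4 : T.card ≤ (V ∩ T).card + C.card := by
        refine (card_le_card fun y hy => ?_).trans (card_union_le _ _)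
        by_cases hyC : y ∈ C
        · exact mem_union_right _ hyC
        · exact mem_union_left _ (mem_inter.2 ⟨mem_sdiff.2 ⟨hTU hy, hyC⟩, hy⟩)
      have h5 := card_pos.2 h3
      rcases hgap T hT0 with hs | hl
      · obtain ⟨b, hb⟩ : ∃ b, (V \ T).card = p ^ m + b := ⟨(V \ T).card - p ^ m, by omega⟩
        rw [hb, choose_prime_pow_add_eq_choose hp m b (by omega),
          Nat.choose_eq_zero_of_lt (by omega), Nat.cast_zero, mul_zero]
      · rw [Nat.choose_eq_zero_of_lt (by omega), Nat.cast_zero, mul_zero]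
    · rw [zero_mul]
  · simp

/-- A basis of `G`: elements `e j` of order `n j` with coordinate maps `π j` into `ZMod (n j)`. -/
theorem exists_dual_generators (G : Type*) [AddCommGroup G] [Finite G] :
    ∃ (κ : Type) (_ : Fintype κ) (_ : DecidableEq κ) (n : κ → ℕ) (e : κ → G)
      (π : ∀ j, G →+ ZMod (n j)),
      (∀ j, 1 < n j) ∧ (∀ j, addOrderOf (e j) = n j) ∧
      (∀ j k, π j (e k) = if k = j then 1 else 0) ∧
      AddSubgroup.closure (Set.range e) = ⊤ := by
  classical
  obtain ⟨κ, _, n, hn, ⟨f⟩⟩ := AddCommGroup.equiv_directSum_zmod_of_finite' G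
  let F : G ≃+ (∀ j, ZMod (n j)) := f.trans (DirectSum.addEquivProd _)
  refine ⟨κ, inferInstance, inferInstance, n, fun j => F.symm (Pi.single j 1),
    fun j => (Pi.evalAddMonoidHom _ j).comp F.toAddMonoidHom, hn, fun j => ?_, fun j k => ?_, ?_⟩
  · rw [AddEquiv.addOrderOf_eq]
    exact (addOrderOf_injective (AddMonoidHom.single (fun j => ZMod (n j)) j)
      (Pi.single_injective (M := fun j => ZMod (n j)) j) 1).trans (ZMod.addOrderOf_one _)
  · rcases eq_or_ne k j with rfl | h
    · simp
    · simp [h]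
  · rw [eq_top_iff]
    intro x _
    have hx : x = ∑ j, ((F x j).cast : ℤ) • F.symm (Pi.single j 1) := by
      apply F.injective
      rw [map_sum]
      conv_lhs => rw [← Finset.univ_sum_single (F x)]
      refine sum_congr rfl fun j _ => ?_
      rw [map_zsmul, AddEquiv.apply_symm_apply, ← Pi.single_smul, zsmul_one,
        ZMod.intCast_zmod_cast]
    rw [hx]
    exact AddSubgroup.sum_mem _ fun j _ =>
      AddSubgroup.zsmul_mem _ (AddSubgroup.subset_closure (Set.mem_range_self j)) _

theorem Multiset.exists_map_univ_eq {α : Type*} (S : Multiset α) :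
    ∃ g : Fin (card S) → α, Multiset.map g (Finset.univ : Finset (Fin (card S))).val = S := by
  induction S using Quotient.inductionOn with
  | h l =>
    exact ⟨l.get, (Fin.univ_val_map l.get).trans (congrArg _ (List.ofFn_get l))⟩

theorem card_lt_davenport {G : Type*} [AddCommGroup G] {ℓ : ℕ} (hℓ : 0 < ℓ)
    (hbound : ∀ S : Multiset G, ℓ ≤ Multiset.card S → ∃ T ≤ S, T ≠ 0 ∧ T.sum = 0)
    {S : Multiset G} (hS : ∀ T ≤ S, T.sum = 0 → T = 0) :
    Multiset.card S < davenport G := by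
  by_contra! h
  have hmem : davenport G ∈ {ℓ : ℕ | 0 < ℓ ∧ ∀ S : Multiset G, ℓ ≤ Multiset.card S →
      ∃ T : Multiset G, T ≤ S ∧ T ≠ 0 ∧ T.sum = 0 ∧ Multiset.card T ∈ {t | 0 < t}} := by
    refine Nat.sInf_mem ⟨ℓ, hℓ, fun S hS => ?_⟩
    obtain ⟨T, hT, hT0, hTsum⟩ := hbound S hS
    exact ⟨T, hT, hT0, hTsum, Multiset.card_pos.2 hT0⟩
  obtain ⟨T, hT, hT0, hTsum, -⟩ := hmem.2 S h
  exact hT0 (hS T hT hTsum)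

/-- The sequence `∏ (e j) ^ (n j - 1)` is zero-sum free. -/
theorem zeroSumFree_sum_replicate {κ G : Type*} [Fintype κ] [DecidableEq κ] [AddCommGroup G]
    {n : κ → ℕ} {e : κ → G} {π : ∀ j, G →+ ZMod (n j)} (hn : ∀ j, 1 < n j)
    (hπ : ∀ j k, π j (e k) = if k = j then 1 else 0) {T : Multiset G}
    (hT : T ≤ ∑ j, Multiset.replicate (n j - 1) (e j)) (hsum : T.sum = 0) : T = 0 := by
  classical
  have he : ∀ j k, e j = e k ↔ j = k := by
    refine fun j k => ⟨fun h => ?_, fun h => h ▸ rfl⟩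
    by_contra hjk
    have : Fact (1 < n k) := ⟨hn k⟩
    have h1 := hπ k j
    rw [h, hπ, if_pos rfl, if_neg hjk] at h1
    exact one_ne_zero h1
  refine Multiset.eq_zero_of_forall_notMem fun x hx => ?_
  have hrange : ∀ y ∈ T, ∃ j, e j = y := fun y hy => by
    obtain ⟨j, -, hj⟩ := Multiset.mem_sum.1 (Multiset.mem_of_le hT hy)
    exact ⟨j, (Multiset.eq_of_mem_replicate hj).symm⟩
  obtain ⟨k, rfl⟩ := hrange x hx
  have hcoord : ∀ R ≤ T, π k R.sum = (R.count (e k) : ZMod (n k)) := by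
    intro R
    induction R using Multiset.induction_on with
    | empty => simp
    | cons y R ih =>
      intro hR
      obtain ⟨j, rfl⟩ := hrange y (Multiset.mem_of_le hR (Multiset.mem_cons_self _ _))
      rw [Multiset.sum_cons, map_add, ih ((Multiset.le_cons_self _ _).trans hR), hπ,
        Multiset.count_cons, Nat.cast_add, add_comm]
      simp [he, eq_comm]
  have hdvd : n k ∣ T.count (e k) := by
    rw [← ZMod.natCast_eq_zero_iff, ← hcoord T le_rfl, hsum, map_zero]
  have hle := Multiset.count_le_of_le (e k) hT
  simp only [Multiset.count_sum', Multiset.count_replicate, he, Finset.sum_ite_eq',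
    Finset.mem_univ, if_true] at hle
  have hpos := Multiset.count_pos.2 hx
  have := Nat.le_of_dvd hpos hdvd
  omega

theorem zeroSumFree_replicate {G : Type*} [AddCommGroup G] {x : G} {k : ℕ}
    (hk : k < addOrderOf x) {T : Multiset G} (hT : T ≤ Multiset.replicate k x)
    (hsum : T.sum = 0) : T = 0 := by
  obtain ⟨t, ht, rfl⟩ := Multiset.le_replicate_iff.1 hT
  rw [Multiset.sum_replicate] at hsum
  rcases Nat.eq_zero_or_pos t with rfl | h
  · simp
  · have := Nat.le_of_dvd h (addOrderOf_dvd_of_nsmul_eq_zero hsum)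
    omega

/-- Families of length at least `D(G)` have vanishing alternating count of zero-sum subfamilies
modulo `p`, by Olson's formula `D(G) = 1 + ∑ (n j - 1)`; moreover `exp(G) ≤ D(G)`. -/
theorem altZeroSumCount_eq_zero_and_exponent_le_davenport {p : ℕ} (hp : p.Prime) (G : Type*)
    [AddCommGroup G] [Finite G] [DecidableEq G] (hpG : ∀ g : G, ∃ k : ℕ, p ^ k • g = 0) :
    (∀ (ι : Type) (g : ι → G) (U : Finset ι), davenport G ≤ U.card →
      altZeroSumCount (ZMod p) g U = 0) ∧ AddMonoid.exponent G ≤ davenport G := by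
  classical
  have : Fact p.Prime := ⟨hp⟩
  obtain ⟨κ, _, _, n, e, π, hn, hord, hπ, he⟩ := exists_dual_generators G
  have hvanish : ∀ (ι : Type) (g : ι → G) (U : Finset ι), ∑ j, (n j - 1) + 1 ≤ U.card →
      altZeroSumCount (ZMod p) g U = 0 := fun ι g U hU =>
    altZeroSumCount_eq_zero hp he (fun j => by
      obtain ⟨k, hk⟩ := hpG (e j)
      obtain ⟨l, -, hl⟩ := (Nat.dvd_prime_pow hp).1 (addOrderOf_dvd_of_nsmul_eq_zero hk)
      exact ⟨l, hord j ▸ hl⟩) (fun j => hord j ▸ addOrderOf_nsmul_eq_zero _) g hU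
  have hbound : ∀ S : Multiset G, ∑ j, (n j - 1) + 1 ≤ Multiset.card S →
      ∃ T ≤ S, T ≠ 0 ∧ T.sum = 0 := by
    intro S hS
    obtain ⟨g, hg⟩ := S.exists_map_univ_eq
    have h0 := hvanish _ g univ (by simpa using hS)
    obtain ⟨T, hT0, hT⟩ : ∃ T : Finset (Fin (Multiset.card S)), T ≠ ∅ ∧ ∑ j ∈ T, g j = 0 := by
      by_contra! h
      rw [altZeroSumCount, sum_eq_single ∅
        (fun T _ hT => if_neg (h T (nonempty_iff_ne_empty.2 hT))) (by simp)] at h0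
      simp at h0
    exact ⟨T.val.map g, (Multiset.map_le_map (val_le_iff.2 (subset_univ T))).trans_eq hg,
      by simpa using hT0, hT⟩
  refine ⟨fun ι g U hU => hvanish ι g U (le_trans ?_ hU), ?_⟩
  · have := card_lt_davenport (Nat.succ_pos _) hbound
      fun T hT hsum => zeroSumFree_sum_replicate hn hπ hT hsum
    simpa [Multiset.card_sum] using this
  · obtain ⟨x, hx⟩ := AddMonoid.exists_addOrderOf_eq_exponent
      (AddMonoid.ExponentExists.of_finite (G := G))
    have hpos := addOrderOf_pos x
    have := card_lt_davenport (Nat.succ_pos _) hbound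
      fun T hT hsum => zeroSumFree_replicate (Nat.sub_lt hpos one_pos) hT hsum
    rw [Multiset.card_replicate] at this
    omega

/-- For a finite abelian `p`-group `G` with `D(G) ≤ 2·exp(G) − 1` and
`1 ≤ i ≤ 2·exp(G) − D(G)`, any zero-sum sequence over `G` of length exactly `D(G) + i`
contains a nonempty zero-sum subsequence of length at least `i` and at most `exp(G)`. -/
theorem stmt4 (p : ℕ) (hp : p.Prime) (G : Type*) [AddCommGroup G] [Finite G]
    (hpG : ∀ g : G, ∃ k : ℕ, p ^ k • g = 0)
    (hD : davenport G ≤ 2 * AddMonoid.exponent G - 1)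
    (i : ℕ) (hi1 : 1 ≤ i) (hi2 : i ≤ 2 * AddMonoid.exponent G - davenport G)
    (S : Multiset G) (hSsum : S.sum = 0) (hScard : Multiset.card S = davenport G + i) :
    ∃ T : Multiset G, T ≤ S ∧ T ≠ 0 ∧ T.sum = 0 ∧
      i ≤ Multiset.card T ∧ Multiset.card T ≤ AddMonoid.exponent G := by
  classical
  obtain ⟨hvanish, hexp⟩ := altZeroSumCount_eq_zero_and_exponent_le_davenport hp G hpG
  obtain ⟨m, hm⟩ : ∃ m, AddMonoid.exponent G = p ^ m := by
    obtain ⟨x, hx⟩ := AddMonoid.exists_addOrderOf_eq_exponent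
      (AddMonoid.ExponentExists.of_finite (G := G))
    obtain ⟨k, hk⟩ := hpG x
    obtain ⟨m, -, hm⟩ := (Nat.dvd_prime_pow hp).1 (addOrderOf_dvd_of_nsmul_eq_zero hk)
    exact ⟨m, hx ▸ hm⟩
  rw [hm] at hi2 hexp ⊢
  obtain ⟨g, hg⟩ := S.exists_map_univ_eq
  obtain ⟨T, hT, hiT, hTn⟩ := exists_zeroSum_card_mem_Icc (g := g) hp (hvanish _ g) (m := m)
    (by omega) hi1 hexp (by rw [Fintype.card_fin, hScard])
    ((congrArg Multiset.sum hg).trans hSsum)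
  refine ⟨T.val.map g, (Multiset.map_le_map (val_le_iff.2 (subset_univ T))).trans_eq hg, ?_, hT,
    by simpa using hiT, by simpa using hTn⟩
  rw [← Multiset.card_pos, Multiset.card_map, card_val]
  omega
end

section
/- Let G be a finite abelian group with exponent n = exp(G). Then ζ_i(G) < ζ_{i+1}(G) for all 1 ≤ i ≤ n − 1; moreover ζ_1(G) = D(G). -/
/-- In a finite abelian group, every sufficiently long sequence repeats some element
`exp(G)` times, so it has a zero-sum subsequence of length `exp(G)`. -/
theorem exists_sum_eq_zero_card_eq_exponent (G : Type*) [AddCommGroup G] [Finite G]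
    (S : Multiset G) (hS : Nat.card G * AddMonoid.exponent G ≤ Multiset.card S) :
    ∃ T : Multiset G, T ≤ S ∧ T.sum = 0 ∧ Multiset.card T = AddMonoid.exponent G := by
  classical
  have := Fintype.ofFinite G
  have hpos : 0 < AddMonoid.exponent G := AddMonoid.exponent_pos.2 .of_finite
  obtain ⟨g, hg⟩ : ∃ g : G, AddMonoid.exponent G ≤ S.count g := by
    by_contra! h
    have hlt : ∑ g : G, S.count g < ∑ _g : G, AddMonoid.exponent G :=
      Finset.sum_lt_sum_of_nonempty Finset.univ_nonempty fun g _ => h g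
    rw [Multiset.sum_count_eq_card fun a _ => Finset.mem_univ a] at hlt
    simp only [Finset.sum_const, Finset.card_univ, smul_eq_mul, ← Nat.card_eq_fintype_card]
      at hlt
    omega
  refine ⟨Multiset.replicate (AddMonoid.exponent G) g, Multiset.le_count_iff_replicate_le.1 hg,
    ?_, Multiset.card_replicate _ _⟩
  rw [Multiset.sum_replicate, AddMonoid.exponent_nsmul_eq_zero]

/-- If `exp(G) ∈ L`, the infimum defining `zsInv G L` is attained. -/
theorem zsInv_mem (G : Type*) [AddCommGroup G] [Finite G] {L : Set ℕ}
    (hL : AddMonoid.exponent G ∈ L) :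
    0 < zsInv G L ∧ ∀ S : Multiset G, zsInv G L ≤ Multiset.card S →
      ∃ T : Multiset G, T ≤ S ∧ T ≠ 0 ∧ T.sum = 0 ∧ Multiset.card T ∈ L := by
  have hpos : 0 < AddMonoid.exponent G := AddMonoid.exponent_pos.2 .of_finite
  refine Nat.sInf_mem (s := {ℓ : ℕ | 0 < ℓ ∧ ∀ S : Multiset G, ℓ ≤ Multiset.card S →
    ∃ T : Multiset G, T ≤ S ∧ T ≠ 0 ∧ T.sum = 0 ∧ Multiset.card T ∈ L})
    ⟨Nat.card G * AddMonoid.exponent G, Nat.mul_pos Nat.card_pos hpos, fun S hS => ?_⟩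
  obtain ⟨T, hTS, hT, hcard⟩ := exists_sum_eq_zero_card_eq_exponent G S hS
  exact ⟨T, hTS, Multiset.card_pos.1 (hcard ▸ hpos), hT, hcard ▸ hL⟩

/-- Adjoining `0` to a sequence changes the lengths of its zero-sum subsequences by at most one;
so if `1 ∉ L`, `L ⊆ L'` and `L - 1 ⊆ L'`, then `zsInv G L' < zsInv G L`. -/
theorem zsInv_lt_zsInv (G : Type*) [AddCommGroup G] [Finite G] {L L' : Set ℕ}
    (hL : AddMonoid.exponent G ∈ L) (h_one : 1 ∉ L) (hsub : L ⊆ L')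
    (hpred : ∀ t, 0 < t → t + 1 ∈ L → t ∈ L') : zsInv G L' < zsInv G L := by
  classical
  obtain ⟨hpos, h⟩ := zsInv_mem G hL
  have h_ne_one : zsInv G L ≠ 1 := by
    intro h_eq
    obtain ⟨T, hTS, hT0, -, hT⟩ := h {0} (by simp [h_eq])
    rcases Multiset.le_singleton.1 hTS with rfl | rfl
    · exact hT0 rfl
    · exact h_one (by simpa using hT)
  suffices zsInv G L' ≤ zsInv G L - 1 by omega
  refine Nat.sInf_le ⟨by omega, fun S hS => ?_⟩
  obtain ⟨T, hTS, hT0, hsum, hT⟩ := h (0 ::ₘ S) (by rw [Multiset.card_cons]; omega)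
  by_cases h0 : (0 : G) ∈ T
  · obtain ⟨U, rfl⟩ := Multiset.exists_cons_of_mem h0
    rw [Multiset.card_cons] at hT
    have hU : U ≠ 0 := by
      rintro rfl
      exact h_one (by simpa using hT)
    exact ⟨U, (Multiset.cons_le_cons_iff 0).1 hTS, hU, by simpa using hsum,
      hpred _ (Multiset.card_pos.2 hU) hT⟩
  · exact ⟨T, (Multiset.le_cons_of_notMem h0).1 hTS, hT0, hsum, hsub hT⟩

/-- For a finite abelian group `G` with `n = exp(G)`, `ζ_i(G) < ζ_{i+1}(G)`
for all `1 ≤ i ≤ n − 1`; moreover `ζ_1(G) = D(G)`. -/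
theorem stmt7 (G : Type*) [AddCommGroup G] [Finite G] :
    (∀ i : ℕ, 1 ≤ i → i ≤ AddMonoid.exponent G - 1 → zetaI G i < zetaI G (i + 1)) ∧
      zetaI G 1 = davenport G := by
  have hpos : 0 < AddMonoid.exponent G := AddMonoid.exponent_pos.2 .of_finite
  refine ⟨fun i hi hin => zsInv_lt_zsInv G ⟨hpos, _, by omega, le_rfl, rfl⟩ ?_ ?_ ?_, ?_⟩
  · rintro ⟨-, r, hir, hrn, hr⟩
    rw [Nat.mod_eq_of_lt (by omega)] at hr
    rcases hrn.eq_or_lt with rfl | hlt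
    · simp at hr
    · rw [Nat.mod_eq_of_lt hlt] at hr
      omega
  · rintro t ⟨ht, r, hir, hrn, hr⟩
    exact ⟨ht, r, by omega, hrn, hr⟩
  · rintro t ht ⟨-, r, hir, hrn, hr⟩
    obtain ⟨r, rfl⟩ := Nat.exists_eq_add_of_lt (show 0 < r by omega)
    rw [zero_add] at hir hrn hr
    exact ⟨ht, r, by omega, by omega, Nat.ModEq.add_right_cancel' 1 hr⟩
  · unfold zetaI davenport
    congr 1
    ext t
    refine ⟨fun ht => ht.1, fun ht => ⟨ht, ?_⟩⟩
    rcases Nat.eq_zero_or_pos (t % AddMonoid.exponent G) with h | h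
    · exact ⟨_, hpos, le_rfl, by rw [h, Nat.mod_self]⟩
    · exact ⟨_, h, (Nat.mod_lt _ hpos).le, (Nat.mod_mod _ _).symm⟩
end

section
/- Let G be a finite abelian group with exponent n = exp(G). Then η_i(G) < η_{i+1}(G) for all 1 ≤ i ≤ n − 1; moreover η_1(G) = η(G) and η_n(G) = s(G). -/
/-- A long enough sequence over a finite abelian group repeats some element `exp(G)` times, so
`zsInv G L` is an infimum over a nonempty set as soon as `exp(G) ∈ L`. -/
theorem zsInv_set_nonempty (G : Type*) [AddCommGroup G] [Finite G] {L : Set ℕ}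
    (hL : AddMonoid.exponent G ∈ L) :
    {ℓ : ℕ | 0 < ℓ ∧ ∀ S : Multiset G, ℓ ≤ Multiset.card S →
      ∃ T : Multiset G, T ≤ S ∧ T ≠ 0 ∧ T.sum = 0 ∧ Multiset.card T ∈ L}.Nonempty := by
  classical
  have := Fintype.ofFinite G
  have hn : AddMonoid.exponent G ≠ 0 := AddMonoid.exponent_ne_zero_of_finite
  refine ⟨Fintype.card G * AddMonoid.exponent G + 1, Nat.succ_pos _, fun S hS => ?_⟩
  obtain ⟨g, hg⟩ : ∃ g : G, AddMonoid.exponent G ≤ S.count g := by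
    by_contra! h
    have hle : Multiset.card S ≤ Fintype.card G * AddMonoid.exponent G := by
      rw [← Multiset.sum_count_eq_card (s := Finset.univ) (fun a _ => Finset.mem_univ a)]
      simpa using Finset.sum_le_card_nsmul Finset.univ (fun a => S.count a) _
        (fun a _ => (h a).le)
    omega
  refine ⟨Multiset.replicate (AddMonoid.exponent G) g, Multiset.le_count_iff_replicate_le.1 hg,
    fun h => hn ?_, ?_, ?_⟩
  · simpa using congrArg Multiset.card h
  · rw [Multiset.sum_replicate, AddMonoid.exponent_nsmul_eq_zero]
  · rwa [Multiset.card_replicate]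

/-- Appending a `0` to a sequence shows that allowing lengths down by one strictly decreases the
invariant. -/
theorem etaI_lt_etaI_succ (G : Type*) [AddCommGroup G] [Finite G] {i : ℕ} (hi : 1 ≤ i)
    (hin : i + 1 ≤ AddMonoid.exponent G) : etaI G i < etaI G (i + 1) := by
  classical
  obtain ⟨hpos, hℓ⟩ := Nat.sInf_mem (zsInv_set_nonempty G
    (L := {t | i + 1 ≤ t ∧ t ≤ AddMonoid.exponent G}) ⟨hin, le_rfl⟩)
  change 0 < etaI G (i + 1) at hpos
  change ∀ S : Multiset G, etaI G (i + 1) ≤ Multiset.card S → _ at hℓ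
  have htwo : 2 ≤ etaI G (i + 1) := by
    by_contra! h
    obtain ⟨T, hT, -, -, hcard, -⟩ := hℓ {0} (by rw [Multiset.card_singleton]; omega)
    have := Multiset.card_le_card hT
    rw [Multiset.card_singleton] at this
    omega
  have hle : etaI G i ≤ etaI G (i + 1) - 1 := by
    refine Nat.sInf_le ⟨by omega, fun S hS => ?_⟩
    obtain ⟨T, hT, hT0, hsum, hlow, hupp⟩ :=
      hℓ (0 ::ₘ S) (by rw [Multiset.card_cons]; omega)
    by_cases h0 : (0 : G) ∈ T
    · have hcard := Multiset.card_erase_add_one h0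
      refine ⟨T.erase 0, Multiset.erase_le_iff_le_cons.2 hT, ?_, ?_, by omega, by omega⟩
      · rw [← Multiset.card_pos]
        omega
      · rwa [← Multiset.sum_erase h0, zero_add] at hsum
    · exact ⟨T, (Multiset.le_cons_of_notMem h0).1 hT, hT0, hsum, by omega, hupp⟩
  omega

/-- For a finite abelian group `G` with `n = exp(G)`, `η_i(G) < η_{i+1}(G)`
for all `1 ≤ i ≤ n − 1`; moreover `η_1(G) = η(G)` and `η_n(G) = s(G)`. -/
theorem stmt8 (G : Type*) [AddCommGroup G] [Finite G] :
    (∀ i : ℕ, 1 ≤ i → i ≤ AddMonoid.exponent G - 1 → etaI G i < etaI G (i + 1)) ∧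
      etaI G 1 = etaInv G ∧ etaI G (AddMonoid.exponent G) = egzConst G := by
  refine ⟨fun i hi hin => etaI_lt_etaI_succ G hi (by omega), rfl, ?_⟩
  unfold etaI egzConst
  congr 1
  ext t
  simp only [Set.mem_ofPred_eq, Set.mem_singleton_iff]
  omega
end
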